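/- Let 0 ≤ γ < ∞, 1 ≤ r ≤ ∞ and 0 < q < ∞. Assume γ > 2/q − 1/2 and γ > max{3/(2q) − 1/(2r′), 2/q − 1/r′}. Then there is a constant C > 0 such that for every measurable F : ℝ → ℂ one has ‖R*_γF‖_{L^q(ℝ²)} ≤ C · ‖F‖_{L^r(S¹)}. -/

import Mathlib

open MeasureTheory Real Set Filter
open scoped ENNReal

noncomputable section

/-- Fourier extension operator of the unit circle,
`(R*F)(x,y) = (1/(2π)) ∫_0^{2π} F(φ) exp(i(x cos φ + y sin φ)) dφ`. -/
def Rext (F : ℝ → ℂ) (x y : ℝ) : ℂ :=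
  Complex.ofReal (1 / (2 * π)) *
    ∫ φ in (0:ℝ)..(2 * π),
      F φ * Complex.exp (Complex.I * Complex.ofReal (x * Real.cos φ + y * Real.sin φ))

/-- Weighted extension operator with product weight `(1+|x|)^{-α}(1+|y|)^{-β}`. -/
def Rab (α β : ℝ) (F : ℝ → ℂ) (x y : ℝ) : ℂ :=
  Rext F x y * Complex.ofReal ((1 + |x|) ^ (-α) * (1 + |y|) ^ (-β))

/-- Weighted extension operator with weight `(1+|x|+|y|)^{-γ}`. -/
def Rgamma (γ : ℝ) (F : ℝ → ℂ) (x y : ℝ) : ℂ :=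
  Rext F x y * Complex.ofReal ((1 + |x| + |y|) ^ (-γ))

/-- `L^r` norm on the circle, parametrized by `[0, 2π]`. -/
def circleLp (r : ℝ≥0∞) (F : ℝ → ℂ) : ℝ≥0∞ :=
  eLpNorm F r (volume.restrict (Ioc (0:ℝ) (2 * π)))

/-- `L^q` quasinorm on the plane. -/
def planeLp (q : ℝ≥0∞) (g : ℝ × ℝ → ℂ) : ℝ≥0∞ :=
  eLpNorm g q (volume : Measure (ℝ × ℝ))

/-- Weak `L^q` quasinorm on the line. -/
def wline (q : ℝ) (g : ℝ → ℂ) : ℝ≥0∞ :=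
  ⨆ (t : ℝ) (_ : 0 < t), ENNReal.ofReal t * (volume {x : ℝ | t < ‖g x‖}) ^ (1 / q)

/-- Weak `L^q` quasinorm on the line, for `ℝ≥0∞`-valued functions. -/
def wlineE (q : ℝ) (g : ℝ → ℝ≥0∞) : ℝ≥0∞ :=
  ⨆ (t : ℝ) (_ : 0 < t), ENNReal.ofReal t * (volume {x : ℝ | ENNReal.ofReal t < g x}) ^ (1 / q)

/-- Mixed weak quasinorm `L^{q,∞}_x(L^{q,∞}_y)`. -/
def mixedXY (q : ℝ) (g : ℝ × ℝ → ℂ) : ℝ≥0∞ :=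
  wlineE q fun x => wline q fun y => g (x, y)

/-- Mixed weak quasinorm `L^{q,∞}_y(L^{q,∞}_x)`. -/
def mixedYX (q : ℝ) (g : ℝ × ℝ → ℂ) : ℝ≥0∞ :=
  wlineE q fun y => wline q fun x => g (x, y)

/-- Weak `L^q` quasinorm on the plane. -/
def wplane (q : ℝ) (g : ℝ × ℝ → ℂ) : ℝ≥0∞ :=
  ⨆ (t : ℝ) (_ : 0 < t), ENNReal.ofReal t * (volume {p : ℝ × ℝ | t < ‖g p‖}) ^ (1 / q)

/-- Lorentz `L^{r,1}` norm on the circle. -/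
def lorentz1 (r : ℝ) (F : ℝ → ℂ) : ℝ≥0∞ :=
  ∫⁻ t in Ioi (0:ℝ), (volume {φ ∈ Icc (0:ℝ) (2 * π) | t < ‖F φ‖}) ^ (1 / r)

/-- Weak `L^r` quasinorm on the circle. -/
def wcircle (r : ℝ) (F : ℝ → ℂ) : ℝ≥0∞ :=
  ⨆ (t : ℝ) (_ : 0 < t), ENNReal.ofReal t * (volume {φ ∈ Icc (0:ℝ) (2 * π) | t < ‖F φ‖}) ^ (1 / r)


/-- Oscillatory integral operator with phase `(u,v)`. -/
def Tm {X : Type*} [MeasurableSpace X] (μ : Measure X) (u v : X → ℝ) (h : X → ℂ) (z : ℝ × ℝ) : ℂ :=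
  ∫ t, h t * Complex.exp (Complex.I * Complex.ofReal (z.1 * u t + z.2 * v t)) ∂μ

lemma Tm_meas {X : Type*} [MeasurableSpace X] (μ : Measure X) [SFinite μ] (u v : X → ℝ)
    (hu : Measurable u) (hv : Measurable v) (h : X → ℂ) (hh : Measurable h) :
    Measurable (Tm μ u v h) := by
  have : StronglyMeasurable (Function.uncurry fun (z : ℝ × ℝ) (t : X) =>
      h t * Complex.exp (Complex.I * Complex.ofReal (z.1 * u t + z.2 * v t))) := by
    apply Measurable.stronglyMeasurable
    unfold Function.uncurry
    fun_prop
  exact (this.integral_prod_right (ν := μ)).measurable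

lemma Tm_le {X : Type*} [MeasurableSpace X] (μ : Measure X) (u v : X → ℝ) (h : X → ℂ) (z : ℝ × ℝ) :
    ‖Tm μ u v h z‖ₑ ≤ ∫⁻ t, ‖h t‖ₑ ∂μ := by
  refine (enorm_integral_le_lintegral_enorm _).trans (le_of_eq ?_)
  congr 1
  ext t
  rw [enorm_mul]
  have : ‖Complex.exp (Complex.I * Complex.ofReal (z.1 * u t + z.2 * v t))‖ₑ = 1 := by
    rw [← ofReal_norm, mul_comm, Complex.norm_exp_ofReal_mul_I]; simp
  rw [this, mul_one]

lemma gauss2 (l : ℝ) (hl : 0 < l) (d e : ℝ) :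
    ‖∫ z : ℝ × ℝ, Complex.exp (Complex.I * Complex.ofReal (z.1 * d + z.2 * e)) *
      Complex.ofReal (Real.exp (-l * (z.1 ^ 2 + z.2 ^ 2)))‖ =
      (π / l) * Real.exp (-(d ^ 2 + e ^ 2) / (4 * l)) := by
  have key : ∀ d : ℝ, ‖∫ x : ℝ, Complex.exp (Complex.I * d * x) * Complex.exp (-(l:ℂ) * x ^ 2)‖
      = √(π / l) * Real.exp (-d ^ 2 / (4 * l)) := by
    intro d
    rw [fourierIntegral_gaussian (by simpa using hl), norm_mul]
    congr 1
    · rw [show (π / l : ℂ) = ((π / l : ℝ) : ℂ) by push_cast; rfl,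
        Complex.norm_cpow_eq_rpow_re_of_pos (by positivity), Real.sqrt_eq_rpow]
      norm_num
    · rw [show (-(d:ℂ) ^ 2 / (4 * l) : ℂ) = ((-d ^ 2 / (4 * l) : ℝ) : ℂ) by push_cast; rfl,
        ← Complex.ofReal_exp, Complex.norm_real, Real.norm_eq_abs, abs_of_pos (Real.exp_pos _)]
  have : (fun z : ℝ × ℝ => Complex.exp (Complex.I * Complex.ofReal (z.1 * d + z.2 * e)) *
      Complex.ofReal (Real.exp (-l * (z.1 ^ 2 + z.2 ^ 2)))) = fun z : ℝ × ℝ =>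
      (Complex.exp (Complex.I * d * z.1) * Complex.exp (-(l:ℂ) * z.1 ^ 2)) *
      (Complex.exp (Complex.I * e * z.2) * Complex.exp (-(l:ℂ) * z.2 ^ 2)) := by
    ext z
    push_cast
    simp only [← Complex.exp_add]
    congr 1
    ring
  rw [this, Measure.volume_eq_prod, integral_prod_mul (f := fun x : ℝ => Complex.exp (Complex.I * d * x) * Complex.exp (-(l:ℂ) * x ^ 2)) (g := fun x : ℝ => Complex.exp (Complex.I * e * x) * Complex.exp (-(l:ℂ) * x ^ 2)), norm_mul, key, key,
    mul_mul_mul_comm, Real.mul_self_sqrt (by positivity), ← Real.exp_add]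
  congr 2
  ring

lemma gaussInt (l : ℝ) (hl : 0 < l) :
    Integrable (fun z : ℝ × ℝ => Real.exp (-l * (z.1 ^ 2 + z.2 ^ 2))) := by
  have := (integrable_exp_neg_mul_sq hl).mul_prod (integrable_exp_neg_mul_sq hl)
  rw [Measure.volume_eq_prod]
  refine this.congr (ae_of_all _ fun z => ?_)
  simp only [← Real.exp_add]
  congr 1; ring

lemma gaussT {X : Type*} [MeasurableSpace X] (μ : Measure X) [IsFiniteMeasure μ] (u v : X → ℝ)
    (hu : Measurable u) (hv : Measurable v) (h : X → ℂ) (hh : Measurable h) (hb : ∀ t, ‖h t‖ ≤ 1)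
    (l : ℝ) (hl : 0 < l) (A : ℝ≥0∞)
    (hA : ∀ᵐ t ∂μ, ∫⁻ s, ENNReal.ofReal
      ((π / l) * Real.exp (-((u t - u s) ^ 2 + (v t - v s) ^ 2) / (4 * l))) ∂μ ≤ A) :
    ∫⁻ z : ℝ × ℝ, ‖Tm μ u v h z‖ₑ ^ 2 * ENNReal.ofReal (Real.exp (-l * (z.1 ^ 2 + z.2 ^ 2)))
      ≤ A * ∫⁻ t, ‖h t‖ₑ ∂μ := by
  have hint : Integrable h μ := Integrable.of_bound hh.aestronglyMeasurable 1 (ae_of_all _ hb)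
  set W : ℝ × ℝ → ℝ := fun z => Real.exp (-l * (z.1 ^ 2 + z.2 ^ 2)) with hW
  set K : X × X → ℝ × ℝ → ℂ := fun p z => (h p.1 * (starRingEnd ℂ) (h p.2)) *
    (Complex.exp (Complex.I * Complex.ofReal (z.1 * (u p.1 - u p.2) + z.2 * (v p.1 - v p.2))) *
      Complex.ofReal (W z)) with hK
  have hsq : ∀ z, ((‖Tm μ u v h z‖ ^ 2 * W z : ℝ) : ℂ) = ∫ p, K p z ∂(μ.prod μ) := by
    intro z
    have e1 : (fun p : X × X => K p z) = fun p => ((h p.1 * Complex.exp (Complex.I * Complex.ofReal (z.1 * u p.1 + z.2 * v p.1))) *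
       (starRingEnd ℂ) (h p.2 * Complex.exp (Complex.I * Complex.ofReal (z.1 * u p.2 + z.2 * v p.2)))) * W z := by
      ext p
      simp only [hK, map_mul, ← Complex.exp_conj, Complex.conj_I, Complex.conj_ofReal]
      rw [show Complex.I * Complex.ofReal (z.1 * (u p.1 - u p.2) + z.2 * (v p.1 - v p.2)) =
        Complex.I * Complex.ofReal (z.1 * u p.1 + z.2 * v p.1) + -Complex.I * Complex.ofReal (z.1 * u p.2 + z.2 * v p.2) by push_cast; ring, Complex.exp_add]
      ring
    rw [e1, integral_mul_const, integral_prod_mul (f := fun t => h t * Complex.exp (Complex.I * Complex.ofReal (z.1 * u t + z.2 * v t))) (g := fun t => (starRingEnd ℂ) (h t * Complex.exp (Complex.I * Complex.ofReal (z.1 * u t + z.2 * v t)))), integral_conj]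
    change _ = Tm μ u v h z * (starRingEnd ℂ) (Tm μ u v h z) * _
    rw [Complex.mul_conj, Complex.normSq_eq_norm_sq]
    push_cast; rfl
  have hKm : Measurable (Function.uncurry K) := by
    unfold Function.uncurry
    simp only [hK, hW]
    have : Measurable (starRingEnd ℂ) := Complex.continuous_conj.measurable
    fun_prop
  have hKint : Integrable (Function.uncurry K) ((μ.prod μ).prod volume) := by
    have h1 : Integrable (fun p : X × X => (1:ℝ)) (μ.prod μ) := integrable_const _
    have := h1.mul_prod (gaussInt l hl)
    refine this.mono' hKm.aestronglyMeasurable (ae_of_all _ fun q => ?_)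
    simp only [Function.uncurry, hK, norm_mul, RCLike.norm_conj, Complex.norm_real]
    rw [mul_comm Complex.I, Complex.norm_exp_ofReal_mul_I, one_mul, Real.norm_eq_abs, abs_of_pos (Real.exp_pos _)]
    gcongr
    exact mul_le_one₀ (hb _) (norm_nonneg _) (hb _)
  have hfin : Integrable (fun z => ((‖Tm μ u v h z‖ ^ 2 * W z : ℝ) : ℂ)) := by
    simp_rw [hsq]
    exact hKint.integral_prod_right
  have hfinR : Integrable (fun z => ‖Tm μ u v h z‖ ^ 2 * W z) := by
    have := hfin.re
    simpa only [RCLike.re_to_complex, Complex.ofReal_re] using this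
  have hW0 : ∀ z, 0 ≤ W z := fun z => (Real.exp_pos _).le
  have e0 : ∫⁻ z : ℝ × ℝ, ‖Tm μ u v h z‖ₑ ^ 2 * ENNReal.ofReal (W z) =
      ‖∫ z, ((‖Tm μ u v h z‖ ^ 2 * W z : ℝ) : ℂ)‖ₑ := by
    rw [integral_complex_ofReal, ← ofReal_norm, Complex.norm_real, Real.norm_eq_abs,
      abs_of_nonneg (integral_nonneg fun z => mul_nonneg (by positivity) (hW0 z)),
      ofReal_integral_eq_lintegral_ofReal hfinR (ae_of_all _ fun z => mul_nonneg (by positivity) (hW0 z))]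
    congr 1; ext z
    rw [ENNReal.ofReal_mul (by positivity), ENNReal.ofReal_pow (norm_nonneg _), ofReal_norm]
  rw [e0]
  simp_rw [hsq]
  rw [← integral_integral_swap hKint]
  refine (enorm_integral_le_lintegral_enorm _).trans ?_
  have e2 : ∀ p : X × X, ‖∫ z, K p z‖ₑ ≤ ‖h p.1‖ₑ * ENNReal.ofReal
      ((π / l) * Real.exp (-((u p.1 - u p.2) ^ 2 + (v p.1 - v p.2) ^ 2) / (4 * l))) := by
    intro p
    simp only [hK]
    rw [integral_const_mul, enorm_mul, ← gauss2 l hl, ofReal_norm, enorm_mul]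
    gcongr
    rw [← ofReal_norm ((starRingEnd ℂ) (h p.2)), RCLike.norm_conj]
    calc _ ≤ ‖h p.1‖ₑ * ENNReal.ofReal 1 := by gcongr; exact hb _
      _ = _ := by simp
  refine (lintegral_mono e2).trans ?_
  rw [lintegral_prod _ (by fun_prop)]
  calc _ = ∫⁻ t, ‖h t‖ₑ * (∫⁻ s, ENNReal.ofReal
      ((π / l) * Real.exp (-((u t - u s) ^ 2 + (v t - v s) ^ 2) / (4 * l))) ∂μ) ∂μ := by
        congr 1; ext t
        dsimp only
        rw [lintegral_const_mul _ (by fun_prop)]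
    _ ≤ ∫⁻ t, ‖h t‖ₑ * A ∂μ := by
        refine lintegral_mono_ae ?_
        filter_upwards [hA] with t ht
        gcongr
    _ = _ := by rw [lintegral_mul_const _ (by fun_prop), mul_comm]

lemma lgauss (b : ℝ) (hb : 0 < b) (c : ℝ) :
    ∫⁻ x : ℝ, ENNReal.ofReal (Real.exp (-b * (x - c) ^ 2)) = ENNReal.ofReal (√(π / b)) := by
  rw [lintegral_sub_right_eq_self (fun x : ℝ => ENNReal.ofReal (Real.exp (-b * x ^ 2))) c,
    ← integral_gaussian, ofReal_integral_eq_lintegral_ofReal (integrable_exp_neg_mul_sq hb)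
      (ae_of_all _ fun x => (Real.exp_pos _).le)]

lemma lgauss2 (α β σ c : ℝ) (hα : 0 < α) (hβ : 0 < β) :
    ∫⁻ p : ℝ × ℝ, ENNReal.ofReal (Real.exp (-α * (p.1 + p.2 - σ) ^ 2)) *
      ENNReal.ofReal (Real.exp (-β * (p.2 - p.1 - c) ^ 2)) =
      ENNReal.ofReal (√(π / (4 * α))) * ENNReal.ofReal (√(π / β)) := by
  rw [Measure.volume_eq_prod, lintegral_prod _ (by fun_prop)]
  dsimp only
  have e1 : ∀ x : ℝ, ∫⁻ y : ℝ, ENNReal.ofReal (Real.exp (-α * (x + y - σ) ^ 2)) *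
      ENNReal.ofReal (Real.exp (-β * (y - x - c) ^ 2)) =
      ∫⁻ d : ℝ, ENNReal.ofReal (Real.exp (-(4 * α) * (x - (σ - d) / 2) ^ 2)) *
      ENNReal.ofReal (Real.exp (-β * (d - c) ^ 2)) := by
    intro x
    rw [← lintegral_sub_right_eq_self (fun d : ℝ =>
      ENNReal.ofReal (Real.exp (-(4 * α) * (x - (σ - d) / 2) ^ 2)) *
      ENNReal.ofReal (Real.exp (-β * (d - c) ^ 2))) x]
    congr 1; ext y
    congr 3
    ring
  simp_rw [e1]
  rw [lintegral_lintegral_swap (by fun_prop)]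
  have e2 : ∀ d : ℝ, ∫⁻ x : ℝ, ENNReal.ofReal (Real.exp (-(4 * α) * (x - (σ - d) / 2) ^ 2)) *
      ENNReal.ofReal (Real.exp (-β * (d - c) ^ 2)) = ENNReal.ofReal (√(π / (4 * α))) *
      ENNReal.ofReal (Real.exp (-β * (d - c) ^ 2)) := by
    intro d
    rw [lintegral_mul_const _ (by fun_prop), lgauss (4 * α) (by positivity)]
  simp_rw [e2]
  rw [lintegral_const_mul _ (by fun_prop), lgauss β hβ]

lemma pi_sq_le : π ^ 2 ≤ 10 := by
  have := Real.pi_lt_d2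
  have := Real.pi_pos
  nlinarith

lemma one_sub_cos_ge (x : ℝ) (hx : |x| ≤ 1) : x ^ 2 / 5 ≤ 1 - Real.cos x := by
  have h := Real.cos_le_one_sub_mul_cos_sq (x := x) (by linarith [Real.pi_gt_three])
  have : 1 / 5 ≤ 2 / π ^ 2 := by
    rw [div_le_div_iff₀ (by norm_num) (by positivity)]
    linarith [pi_sq_le]
  nlinarith [sq_nonneg x]

lemma circ_lower (t s : ℝ) (h : |t - s| ≤ 1) :
    (t - s) ^ 2 / 4 ≤ (Real.cos t - Real.cos s) ^ 2 + (Real.sin t - Real.sin s) ^ 2 := by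
  have h1 := one_sub_cos_ge (t - s) h
  rw [Real.cos_sub] at h1
  nlinarith [Real.sin_sq_add_cos_sq t, Real.sin_sq_add_cos_sq s, sq_nonneg (t - s)]

lemma cos_abs_diff (E E' δ : ℝ) (hE : δ / 2 ≤ E) (hE' : δ / 2 ≤ E') (hδ : 0 < δ)
    (h1 : E ≤ 1 / 2) (h2 : E' ≤ 1 / 2) :
    δ ^ 2 / 25 * (E - E') ^ 2 ≤ (Real.cos E - Real.cos E') ^ 2 := by
  have hp := Real.pi_gt_three
  have key : ∀ x : ℝ, |x| ≤ 1 → 2 / 5 * x ^ 2 ≤ Real.sin x ^ 2 := by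
    intro x hx
    have := one_sub_cos_ge
    have h := Real.mul_abs_le_abs_sin (x := x) (by linarith)
    have h' : (2 / π * |x|) ^ 2 ≤ |Real.sin x| ^ 2 := by gcongr
    rw [sq_abs, mul_pow, sq_abs] at h'
    have : 2 / 5 ≤ (2 / π) ^ 2 := by
      rw [div_pow, div_le_div_iff₀ (by norm_num) (by positivity)]
      linarith [pi_sq_le]
    nlinarith [sq_nonneg x]
  rw [Real.cos_sub_cos]
  have k1 := key ((E + E') / 2) (by rw [abs_le]; constructor <;> linarith)
  have k2 := key ((E - E') / 2) (by rw [abs_le]; constructor <;> linarith)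
  have k3 : (2 / 5 * ((E + E') / 2) ^ 2) * (2 / 5 * ((E - E') / 2) ^ 2) ≤
    Real.sin ((E + E') / 2) ^ 2 * Real.sin ((E - E') / 2) ^ 2 := by gcongr
  have k4 : δ ^ 2 ≤ (E + E') ^ 2 := by gcongr; linarith
  have k5 : δ ^ 2 * (E - E') ^ 2 ≤ (E + E') ^ 2 * (E - E') ^ 2 := by gcongr
  nlinarith

lemma bil_lower (a θ φ θ' φ' δ : ℝ) (hθ : θ ∈ Ioc a (a + 1)) (hφ : φ ∈ Ioc a (a + 1))
    (hθ' : θ' ∈ Ioc a (a + 1)) (hφ' : φ' ∈ Ioc a (a + 1)) (hδ : 0 < δ)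
    (h1 : δ ≤ |φ - θ|) (h2 : δ ≤ |φ' - θ'|) :
    (θ' + φ' - (θ + φ)) ^ 2 / 10 + δ ^ 2 / 25 * (|φ' - θ'| - |φ - θ|) ^ 2 ≤
    ((Real.cos θ + Real.cos φ) - (Real.cos θ' + Real.cos φ')) ^ 2 +
    ((Real.sin θ + Real.sin φ) - (Real.sin θ' + Real.sin φ')) ^ 2 := by
  have hE : |φ - θ| ≤ 1 := by rw [abs_le]; constructor <;> linarith [hθ.1, hθ.2, hφ.1, hφ.2]
  have hE' : |φ' - θ'| ≤ 1 := by rw [abs_le]; constructor <;> linarith [hθ'.1, hθ'.2, hφ'.1, hφ'.2]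
  have c := cos_abs_diff (|φ' - θ'| / 2) (|φ - θ| / 2) δ (by linarith) (by linarith) hδ
    (by linarith) (by linarith)
  have ce : Real.cos (|φ - θ| / 2) = Real.cos ((θ - φ) / 2) := by
    rw [← Real.cos_abs ((θ - φ) / 2), abs_div, abs_sub_comm]; norm_num
  have ce' : Real.cos (|φ' - θ'| / 2) = Real.cos ((θ' - φ') / 2) := by
    rw [← Real.cos_abs ((θ' - φ') / 2), abs_div, abs_sub_comm]; norm_num
  have b := Real.one_sub_sq_div_two_le_cos (x := |φ - θ| / 2)
  have b' := Real.one_sub_sq_div_two_le_cos (x := |φ' - θ'| / 2)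
  rw [ce] at c b
  rw [ce'] at c b'
  have m := one_sub_cos_ge ((θ' + φ') / 2 - (θ + φ) / 2) (by
    rw [abs_le]; constructor <;> linarith [hθ'.1, hθ'.2, hφ'.1, hφ'.2, hθ.1, hθ.2, hφ.1, hφ.2])
  rw [Real.cos_add_cos, Real.cos_add_cos, Real.sin_add_sin, Real.sin_add_sin]
  rw [Real.cos_sub ((θ' + φ') / 2)] at m
  have s1 := Real.sin_sq_add_cos_sq ((θ' + φ') / 2)
  have s2 := Real.sin_sq_add_cos_sq ((θ + φ) / 2)
  have q1 : 7 / 8 ≤ Real.cos ((θ - φ) / 2) := by nlinarith [abs_nonneg (φ - θ)]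
  have q2 : 7 / 8 ≤ Real.cos ((θ' - φ') / 2) := by nlinarith [abs_nonneg (φ' - θ')]
  generalize Real.cos ((θ' + φ') / 2) = x' at *
  generalize Real.sin ((θ' + φ') / 2) = y' at *
  generalize Real.cos ((θ + φ) / 2) = x at *
  generalize Real.sin ((θ + φ) / 2) = y at *
  generalize Real.cos ((θ - φ) / 2) = r at *
  generalize Real.cos ((θ' - φ') / 2) = r' at *
  have e : (2 * x * r - 2 * x' * r') ^ 2 + (2 * y * r - 2 * y' * r') ^ 2 =
    4 * (r' - r) ^ 2 + 8 * (r * r') * (1 - (x' * x + y' * y)) := by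
    linear_combination (4 * r' ^ 2) * s1 + (4 * r ^ 2) * s2
  rw [e]
  have q3 : 3 / 4 ≤ r * r' := by nlinarith
  have q4 : 3 / 4 * (((θ' + φ') / 2 - (θ + φ) / 2) ^ 2 / 5) ≤ (r * r') * (1 - (x' * x + y' * y)) := by
    gcongr
  nlinarith [sq_nonneg (θ' + φ' - (θ + φ))]

/-- Lebesgue measure on the unit arc starting at `a`. -/
def arc (a : ℝ) : Measure ℝ := volume.restrict (Ioc a (a + 1))

instance (a : ℝ) : IsFiniteMeasure (arc a) := by unfold arc; infer_instance

lemma arc_mem (a : ℝ) : ∀ᵐ t ∂(arc a), t ∈ Ioc a (a + 1) := ae_restrict_mem measurableSet_Ioc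

lemma single_kernel (a t l : ℝ) (hl : 0 < l) (ht : t ∈ Ioc a (a + 1)) :
    ∫⁻ s, ENNReal.ofReal ((π / l) * Real.exp (-((Real.cos t - Real.cos s) ^ 2 +
      (Real.sin t - Real.sin s) ^ 2) / (4 * l))) ∂(arc a) ≤
      ENNReal.ofReal ((π / l) * √(π * (16 * l))) := by
  calc _ ≤ ∫⁻ s, ENNReal.ofReal (π / l) *
        ENNReal.ofReal (Real.exp (-(1 / (16 * l)) * (s - t) ^ 2)) ∂(arc a) := by
        refine lintegral_mono_ae ?_
        filter_upwards [arc_mem a] with s hs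
        rw [← ENNReal.ofReal_mul (by positivity)]
        gcongr
        have := circ_lower t s (by rw [abs_le]; constructor <;> linarith [ht.1, ht.2, hs.1, hs.2])
        rw [neg_mul, neg_div, neg_le_neg_iff, div_mul_eq_mul_div, div_le_div_iff₀ (by positivity) (by positivity)]
        nlinarith
    _ ≤ ∫⁻ s, ENNReal.ofReal (π / l) *
        ENNReal.ofReal (Real.exp (-(1 / (16 * l)) * (s - t) ^ 2)) :=
        lintegral_mono' Measure.restrict_le_self le_rfl
    _ = _ := by
        rw [lintegral_const_mul _ (by fun_prop), lgauss _ (by positivity), ← ENNReal.ofReal_mul (by positivity)]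
        congr 3
        field_simp

lemma fact2_scale (a : ℝ) (h : ℝ → ℂ) (hh : Measurable h) (hb : ∀ t, ‖h t‖ ≤ 1) (k : ℕ) :
    ∫⁻ z : ℝ × ℝ, ‖Tm (arc a) Real.cos Real.sin h z‖ₑ ^ 2 *
      ENNReal.ofReal (Real.exp (-((1 / 4) ^ k) * (z.1 ^ 2 + z.2 ^ 2)))
      ≤ ENNReal.ofReal (32 * 2 ^ k) * ∫⁻ t, ‖h t‖ₑ ∂(arc a) := by
  refine gaussT (arc a) _ _ Real.measurable_cos Real.measurable_sin h hh hb _ (by positivity) _ ?_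
  filter_upwards [arc_mem a] with t ht
  refine (single_kernel a t _ (by positivity) ht).trans ?_
  apply ENNReal.ofReal_le_ofReal
  have e1 : ((1:ℝ) / 4) ^ k = ((2:ℝ) ^ k)⁻¹ ^ 2 := by
    rw [← inv_pow, ← pow_mul, mul_comm, pow_mul]; norm_num
  have e2 : √(π * (16 * (1 / 4) ^ k)) = √π * 4 * (2 ^ k)⁻¹ := by
    rw [e1, show π * (16 * ((2:ℝ) ^ k)⁻¹ ^ 2) = π * (4 * ((2:ℝ) ^ k)⁻¹) ^ 2 by ring,
      Real.sqrt_mul (by positivity), Real.sqrt_sq (by positivity)]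
    ring
  have e3 : √π ≤ 2 := by
    rw [Real.sqrt_le_left (by norm_num)]; linarith [Real.pi_le_four]
  rw [e2, e1]
  have : π / (2 ^ k)⁻¹ ^ 2 * (√π * 4 * (2 ^ k)⁻¹) = (π * √π * 4) * 2 ^ k := by
    field_simp
  rw [this]
  gcongr
  nlinarith [Real.pi_le_four, Real.pi_pos, Real.sqrt_nonneg π]

lemma weight_le (ε : ℝ) (hε : 0 < ε) (z : ℝ × ℝ) :
    ENNReal.ofReal ((1 + |z.1| + |z.2|) ^ (-(1 + ε))) ≤
    ∑' k : ℕ, ENNReal.ofReal (Real.exp 4 * ((2:ℝ) ^ (-(1 + ε))) ^ k) *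
      ENNReal.ofReal (Real.exp (-((1 / 4) ^ k) * (z.1 ^ 2 + z.2 ^ 2))) := by
  obtain ⟨k, hk1, hk2⟩ := exists_nat_pow_near (x := 1 + |z.1| + |z.2|) (y := (2:ℝ))
    (by linarith [abs_nonneg z.1, abs_nonneg z.2]) (by norm_num)
  refine le_trans ?_ (ENNReal.le_tsum k)
  rw [← ENNReal.ofReal_mul (by positivity)]
  apply ENNReal.ofReal_le_ofReal
  have a1 : (1 + |z.1| + |z.2|) ^ (-(1 + ε)) ≤ ((2:ℝ) ^ k) ^ (-(1 + ε)) :=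
    Real.rpow_le_rpow_of_nonpos (by positivity) hk1 (by linarith)
  have a2 : ((2:ℝ) ^ k) ^ (-(1 + ε)) = ((2:ℝ) ^ (-(1 + ε))) ^ k := by
    rw [← Real.rpow_natCast, ← Real.rpow_natCast, ← Real.rpow_mul (by norm_num), ← Real.rpow_mul (by norm_num), mul_comm]
  have a3 : 1 ≤ Real.exp 4 * Real.exp (-((1 / 4) ^ k) * (z.1 ^ 2 + z.2 ^ 2)) := by
    rw [← Real.exp_add]
    apply Real.one_le_exp
    have : z.1 ^ 2 + z.2 ^ 2 ≤ (2 ^ (k + 1)) ^ 2 := by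
      rw [← sq_abs z.1, ← sq_abs z.2]
      nlinarith [abs_nonneg z.1, abs_nonneg z.2]
    have e1 : ((1:ℝ) / 4) ^ k * (2 ^ (k + 1)) ^ 2 = 4 := by
      rw [← pow_mul, mul_comm (k+1), pow_mul, pow_succ, ← mul_assoc, ← mul_pow]; norm_num
    have : ((1:ℝ) / 4) ^ k * (z.1 ^ 2 + z.2 ^ 2) ≤ ((1:ℝ) / 4) ^ k * (2 ^ (k + 1)) ^ 2 := by gcongr
    linarith
  rw [← a2]
  calc _ ≤ ((2:ℝ) ^ k) ^ (-(1 + ε)) * 1 := by rw [mul_one]; exact a1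
    _ ≤ ((2:ℝ) ^ k) ^ (-(1 + ε)) * (Real.exp 4 * Real.exp (-((1 / 4) ^ k) * (z.1 ^ 2 + z.2 ^ 2))) := by gcongr
    _ = _ := by ring

lemma tsum_geo (c ρ : ℝ) (hc : 0 ≤ c) (h0 : 0 ≤ ρ) (h1 : ρ < 1) :
    ∑' k : ℕ, ENNReal.ofReal (c * ρ ^ k) ≠ ⊤ := by
  have : Summable fun k : ℕ => c * ρ ^ k := (summable_geometric_of_lt_one h0 h1).mul_left c
  exact this.tsum_ofReal_ne_top

lemma fact2 (ε : ℝ) (hε : 0 < ε) : ∃ C : ℝ≥0∞, C ≠ ⊤ ∧ ∀ (a : ℝ) (h : ℝ → ℂ), Measurable h →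
    (∀ t, ‖h t‖ ≤ 1) →
    ∫⁻ z : ℝ × ℝ, ‖Tm (arc a) Real.cos Real.sin h z‖ₑ ^ 2 *
      ENNReal.ofReal ((1 + |z.1| + |z.2|) ^ (-(1 + ε))) ≤ C * ∫⁻ t, ‖h t‖ₑ ∂(arc a) := by
  refine ⟨∑' k : ℕ, ENNReal.ofReal ((32 * Real.exp 4) * ((2:ℝ) ^ (-ε)) ^ k),
    tsum_geo _ _ (by positivity) (by positivity) (Real.rpow_lt_one_of_one_lt_of_neg (by norm_num) (by linarith)), ?_⟩
  intro a h hh hb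
  have hm := Tm_meas (arc a) _ _ Real.measurable_cos Real.measurable_sin h hh
  calc _ ≤ ∫⁻ z : ℝ × ℝ, ∑' k : ℕ, ENNReal.ofReal (Real.exp 4 * ((2:ℝ) ^ (-(1 + ε))) ^ k) *
      (‖Tm (arc a) Real.cos Real.sin h z‖ₑ ^ 2 * ENNReal.ofReal (Real.exp (-((1 / 4) ^ k) * (z.1 ^ 2 + z.2 ^ 2)))) := by
        refine lintegral_mono fun z => ?_
        refine (mul_le_mul_right (weight_le ε hε z) _).trans (le_of_eq ?_)
        rw [← ENNReal.tsum_mul_left]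
        congr 1; ext k; ring
    _ = ∑' k : ℕ, ENNReal.ofReal (Real.exp 4 * ((2:ℝ) ^ (-(1 + ε))) ^ k) * ∫⁻ z : ℝ × ℝ,
      (‖Tm (arc a) Real.cos Real.sin h z‖ₑ ^ 2 * ENNReal.ofReal (Real.exp (-((1 / 4) ^ k) * (z.1 ^ 2 + z.2 ^ 2)))) := by
        rw [lintegral_tsum (fun k => by fun_prop)]
        congr 1; ext k
        rw [lintegral_const_mul _ (by fun_prop)]
    _ ≤ ∑' k : ℕ, ENNReal.ofReal (Real.exp 4 * ((2:ℝ) ^ (-(1 + ε))) ^ k) *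
        (ENNReal.ofReal (32 * 2 ^ k) * ∫⁻ t, ‖h t‖ₑ ∂(arc a)) := by
        refine ENNReal.tsum_le_tsum fun k => ?_
        gcongr
        exact fact2_scale a h hh hb k
    _ = _ := by
        rw [← ENNReal.tsum_mul_right]
        congr 1; ext k
        rw [← mul_assoc, ← ENNReal.ofReal_mul (by positivity)]
        congr 2
        rw [show (2:ℝ) ^ (-(1 + ε)) = 2 ^ (-ε) * (1 / 2) by
          rw [show -(1 + ε) = -ε + -1 by ring, Real.rpow_add (by norm_num), Real.rpow_neg_one]; norm_num, mul_pow, show (1/2 : ℝ) ^ k = (2 ^ k)⁻¹ by rw [← inv_pow]; norm_num]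
        field_simp

lemma bil_kernel (a δ l : ℝ) (hδ : 0 < δ) (hl : 0 < l) (S : Set (ℝ × ℝ)) (hS : MeasurableSet S)
    (hS' : ∀ p ∈ S, p.1 ∈ Ioc a (a + 1) ∧ p.2 ∈ Ioc a (a + 1) ∧ δ ≤ |p.2 - p.1|)
    (t : ℝ × ℝ) (ht : t ∈ S) :
    ∫⁻ s in S, ENNReal.ofReal ((π / l) * Real.exp (-(((Real.cos t.1 + Real.cos t.2) - (Real.cos s.1 + Real.cos s.2)) ^ 2 +
      ((Real.sin t.1 + Real.sin t.2) - (Real.sin s.1 + Real.sin s.2)) ^ 2) / (4 * l))) ≤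
      ENNReal.ofReal (800 / δ) := by
  set α : ℝ := 1 / (40 * l) with hα
  set β : ℝ := δ ^ 2 / (100 * l) with hβ
  have hα0 : 0 < α := by positivity
  have hβ0 : 0 < β := by positivity
  set J : ℝ → ℝ × ℝ → ℝ≥0∞ := fun c s => ENNReal.ofReal (Real.exp (-α * (s.1 + s.2 - (t.1 + t.2)) ^ 2)) *
      ENNReal.ofReal (Real.exp (-β * (s.2 - s.1 - c) ^ 2)) with hJ
  obtain ⟨t1, t2, t3⟩ := hS' t ht
  calc _ ≤ ∫⁻ s in S, ENNReal.ofReal (π / l) * (J (t.2 - t.1) s + J (-(t.2 - t.1)) s) := by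
        refine lintegral_mono_ae ?_
        filter_upwards [ae_restrict_mem hS] with s hs
        obtain ⟨s1, s2, s3⟩ := hS' s hs
        have := bil_lower a t.1 t.2 s.1 s.2 δ t1 t2 s1 s2 hδ t3 s3
        rw [ENNReal.ofReal_mul (by positivity)]
        gcongr
        have e : Real.exp (-(((Real.cos t.1 + Real.cos t.2) - (Real.cos s.1 + Real.cos s.2)) ^ 2 +
      ((Real.sin t.1 + Real.sin t.2) - (Real.sin s.1 + Real.sin s.2)) ^ 2) / (4 * l)) ≤
          Real.exp (-α * (s.1 + s.2 - (t.1 + t.2)) ^ 2) * Real.exp (-β * (|s.2 - s.1| - |t.2 - t.1|) ^ 2) := by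
          rw [← Real.exp_add]
          apply Real.exp_le_exp.2
          rw [div_le_iff₀ (by positivity)]
          have e1 : (-α * (s.1 + s.2 - (t.1 + t.2)) ^ 2 + -β * (|s.2 - s.1| - |t.2 - t.1|) ^ 2) * (4 * l) =
            -((s.1 + s.2 - (t.1 + t.2)) ^ 2 / 10 + δ ^ 2 / 25 * (|s.2 - s.1| - |t.2 - t.1|) ^ 2) := by
            rw [hα, hβ]; field_simp; ring
          rw [e1]; linarith
        refine (ENNReal.ofReal_le_ofReal e).trans ?_
        rw [ENNReal.ofReal_mul (by positivity)]
        have e2 : (|s.2 - s.1| - |t.2 - t.1|) ^ 2 = (s.2 - s.1 - (t.2 - t.1)) ^ 2 ∨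
           (|s.2 - s.1| - |t.2 - t.1|) ^ 2 = (s.2 - s.1 - (-(t.2 - t.1))) ^ 2 := by
          rcases abs_cases (s.2 - s.1) with h | h <;> rcases abs_cases (t.2 - t.1) with h' | h' <;> rw [h.1, h'.1]
          · left; ring
          · right; ring
          · right; ring
          · left; ring
        rcases e2 with e2 | e2 <;> rw [e2]
        · exact le_self_add
        · exact le_add_self
    _ ≤ ∫⁻ s, ENNReal.ofReal (π / l) * (J (t.2 - t.1) s + J (-(t.2 - t.1)) s) :=
        lintegral_mono' Measure.restrict_le_self le_rfl
    _ = ENNReal.ofReal ((π / l) * (2 * (√(π / (4 * α)) * √(π / β)))) := by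
        rw [lintegral_const_mul _ (by fun_prop), lintegral_add_left (by fun_prop), lgauss2 _ _ _ _ hα0 hβ0,
          lgauss2 _ _ _ _ hα0 hβ0, ENNReal.ofReal_mul (by positivity), two_mul, ENNReal.ofReal_add (by positivity) (by positivity),
          ENNReal.ofReal_mul (by positivity)]
    _ ≤ _ := by
        apply ENNReal.ofReal_le_ofReal
        have e1 : √(π / (4 * α)) * √(π / β) = √1000 * (π * l / δ) := by
          rw [← Real.sqrt_mul (by positivity), hα, hβ]
          rw [show π / (4 * (1 / (40 * l))) * (π / (δ ^ 2 / (100 * l))) = 1000 * (π * l / δ) ^ 2 by field_simp; ring,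
            Real.sqrt_mul (by positivity), Real.sqrt_sq (by positivity)]
        rw [e1]
        have e2 : √1000 ≤ 40 := by
          rw [Real.sqrt_le_left (by norm_num)]; norm_num
        have e3 : π / l * (2 * (√1000 * (π * l / δ))) = (2 * π ^ 2 * √1000) / δ := by field_simp
        rw [e3]
        gcongr
        nlinarith [pi_sq_le, Real.sqrt_nonneg 1000, sq_nonneg π]

lemma bilL2 (a δ : ℝ) (hδ : 0 < δ) (S : Set (ℝ × ℝ)) (hS : MeasurableSet S)
    (hS' : ∀ p ∈ S, p.1 ∈ Ioc a (a + 1) ∧ p.2 ∈ Ioc a (a + 1) ∧ δ ≤ |p.2 - p.1|)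
    (h : ℝ × ℝ → ℂ) (hh : Measurable h) (hb : ∀ t, ‖h t‖ ≤ 1) :
    ∫⁻ z : ℝ × ℝ, ‖Tm (volume.restrict S) (fun p => Real.cos p.1 + Real.cos p.2)
      (fun p => Real.sin p.1 + Real.sin p.2) h z‖ₑ ^ 2 ≤
      ENNReal.ofReal (800 / δ) * ∫⁻ t in S, ‖h t‖ₑ := by
  have hfin : volume S ≠ ⊤ := by
    have : S ⊆ Ioc a (a + 1) ×ˢ Ioc a (a + 1) := fun p hp => ⟨(hS' p hp).1, (hS' p hp).2.1⟩
    refine ne_top_of_le_ne_top ?_ (measure_mono this)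
    rw [Measure.volume_eq_prod, Measure.prod_prod]
    simp
  have : IsFiniteMeasure (volume.restrict S) := ⟨by simpa using hfin.lt_top⟩
  set T := Tm (volume.restrict S) (fun p => Real.cos p.1 + Real.cos p.2)
      (fun p => Real.sin p.1 + Real.sin p.2) h with hT
  have hTm : Measurable T := Tm_meas _ _ _ (by fun_prop) (by fun_prop) h hh
  have hn : ∀ n : ℕ, ∫⁻ z : ℝ × ℝ, ‖T z‖ₑ ^ 2 * ENNReal.ofReal (Real.exp (-(1 / ((n:ℝ) + 1)) * (z.1 ^ 2 + z.2 ^ 2)))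
      ≤ ENNReal.ofReal (800 / δ) * ∫⁻ t in S, ‖h t‖ₑ := by
    intro n
    refine gaussT _ _ _ (by fun_prop) (by fun_prop) h hh hb _ (by positivity) _ ?_
    filter_upwards [ae_restrict_mem hS] with t ht
    exact bil_kernel a δ _ hδ (by positivity) S hS hS' t ht
  have hlim : ∀ z : ℝ × ℝ, Tendsto (fun n : ℕ => ‖T z‖ₑ ^ 2 * ENNReal.ofReal (Real.exp (-(1 / ((n:ℝ) + 1)) * (z.1 ^ 2 + z.2 ^ 2))))
      atTop (nhds (‖T z‖ₑ ^ 2)) := by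
    intro z
    have h0 : Tendsto (fun n : ℕ => (1 / ((n:ℝ) + 1))) atTop (nhds 0) := tendsto_one_div_add_atTop_nhds_zero_nat
    have h1 : Tendsto (fun n : ℕ => Real.exp (-(1 / ((n:ℝ) + 1)) * (z.1 ^ 2 + z.2 ^ 2))) atTop (nhds 1) := by
      have := (Real.continuous_exp.tendsto _).comp (h0.neg.mul_const (z.1 ^ 2 + z.2 ^ 2))
      simpa [Function.comp_def] using this
    have h2 := ENNReal.tendsto_ofReal h1
    have h3 := ENNReal.Tendsto.const_mul (a := ‖T z‖ₑ ^ 2) h2 (Or.inl (by simp))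
    simpa using h3
  calc _ = ∫⁻ z, liminf (fun n : ℕ => ‖T z‖ₑ ^ 2 * ENNReal.ofReal (Real.exp (-(1 / ((n:ℝ) + 1)) * (z.1 ^ 2 + z.2 ^ 2)))) atTop := by
        congr 1; ext z; exact (hlim z).liminf_eq.symm
    _ ≤ _ := lintegral_liminf_le (fun n => by fun_prop)
    _ ≤ liminf (fun n : ℕ => ENNReal.ofReal (800 / δ) * ∫⁻ t in S, ‖h t‖ₑ) atTop :=
        liminf_le_liminf (Eventually.of_forall hn)
    _ = _ := by simp

/-- Whitney strips. -/
def Sk (a : ℝ) (k : ℕ) : Set (ℝ × ℝ) :=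
  (Ioc a (a + 1) ×ˢ Ioc a (a + 1)) ∩ {p | (1 / 2 : ℝ) ^ (k + 1) < |p.2 - p.1| ∧ |p.2 - p.1| ≤ (1 / 2) ^ k}

lemma Sk_meas (a : ℝ) (k : ℕ) : MeasurableSet (Sk a k) := by
  refine (measurableSet_Ioc.prod measurableSet_Ioc).inter ?_
  have h1 : MeasurableSet {p : ℝ × ℝ | (1 / 2 : ℝ) ^ (k + 1) < |p.2 - p.1|} :=
    measurableSet_lt (by fun_prop) (by fun_prop)
  have h2 : MeasurableSet {p : ℝ × ℝ | |p.2 - p.1| ≤ (1 / 2 : ℝ) ^ k} :=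
    measurableSet_le (by fun_prop) (by fun_prop)
  exact h1.inter h2

lemma Sk_disj (a : ℝ) : Pairwise (Function.onFun Disjoint (Sk a)) := by
  have : ∀ i j : ℕ, i < j → Disjoint (Sk a i) (Sk a j) := by
    intro i j hij
    rw [Set.disjoint_left]
    intro p hp hq
    have h1 := hp.2.1
    have h2 := hq.2.2
    have : (1 / 2 : ℝ) ^ j ≤ (1 / 2) ^ (i + 1) := pow_le_pow_of_le_one (by norm_num) (by norm_num) hij
    linarith
  intro i j hij
  rcases lt_or_gt_of_ne hij with h | h
  · exact this i j h
  · exact (this j i h).symm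

lemma diag_null : volume {p : ℝ × ℝ | p.1 = p.2} = 0 := by
  rw [Measure.volume_eq_prod, Measure.measure_prod_null (measurableSet_eq_fun (by fun_prop) (by fun_prop))]
  refine ae_of_all _ fun x => ?_
  have : Prod.mk x ⁻¹' {p : ℝ × ℝ | p.1 = p.2} = {x} := by
    ext y; simp [eq_comm]
  change volume (Prod.mk x ⁻¹' {p : ℝ × ℝ | p.1 = p.2}) = 0
  rw [this]; simp

lemma Sk_union (a : ℝ) : (⋃ k, Sk a k : Set (ℝ × ℝ)) =ᵐ[volume] Ioc a (a + 1) ×ˢ Ioc a (a + 1) := by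
  have : ∀ᵐ p : ℝ × ℝ, ¬ (p.1 = p.2) := by
    rw [ae_iff]; simpa using diag_null
  filter_upwards [this] with p hp
  apply propext
  constructor
  · intro h
    obtain ⟨k, hk⟩ := mem_iUnion.1 h
    exact hk.1
  · intro h
    have hle : |p.2 - p.1| ≤ 1 := by
      rw [abs_le]; constructor <;> linarith [h.1.1, h.1.2, h.2.1, h.2.2]
    have hpos : 0 < |p.2 - p.1| := abs_pos.2 (sub_ne_zero.2 (Ne.symm hp))
    obtain ⟨k, hk⟩ := exists_nat_pow_near_of_lt_one (y := (1/2 : ℝ)) hpos hle (by norm_num) (by norm_num)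
    exact mem_iUnion.2 ⟨k, h, hk⟩

lemma sq_hasSum (a : ℝ) (G : ℝ → ℂ) (hG : Measurable G) (hb : ∀ t, ‖G t‖ ≤ 1) (z : ℝ × ℝ) :
    HasSum (fun k => Tm (volume.restrict (Sk a k)) (fun p => Real.cos p.1 + Real.cos p.2)
      (fun p => Real.sin p.1 + Real.sin p.2) (fun p => G p.1 * G p.2) z)
      (Tm (arc a) Real.cos Real.sin G z ^ 2) := by
  set K : ℝ × ℝ → ℂ := fun p => G p.1 * G p.2 * Complex.exp (Complex.I *
    Complex.ofReal (z.1 * (Real.cos p.1 + Real.cos p.2) + z.2 * (Real.sin p.1 + Real.sin p.2))) with hK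
  have e : Tm (arc a) Real.cos Real.sin G z ^ 2 = ∫ p in ⋃ k, Sk a k, K p := by
    rw [setIntegral_congr_set (Sk_union a), Measure.volume_eq_prod, ← Measure.prod_restrict, sq]
    unfold Tm
    rw [← integral_prod_mul]
    unfold arc
    congr 1; ext p
    simp only [hK]
    rw [show Complex.I * Complex.ofReal (z.1 * (Real.cos p.1 + Real.cos p.2) + z.2 * (Real.sin p.1 + Real.sin p.2)) =
      Complex.I * Complex.ofReal (z.1 * Real.cos p.1 + z.2 * Real.sin p.1) +
      Complex.I * Complex.ofReal (z.1 * Real.cos p.2 + z.2 * Real.sin p.2) by push_cast; ring, Complex.exp_add]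
    ring
  rw [e]
  refine hasSum_integral_iUnion (Sk_meas a) (Sk_disj a) ?_
  have hfin : volume (⋃ k, Sk a k) < ⊤ := by
    rw [measure_congr (Sk_union a), Measure.volume_eq_prod, Measure.prod_prod]; simp
  have : IsFiniteMeasure (volume.restrict (⋃ k, Sk a k)) := ⟨by simpa using hfin⟩
  refine Integrable.of_bound (Measurable.aestronglyMeasurable (by fun_prop)) 1 (ae_of_all _ fun p => ?_)
  simp only [hK, norm_mul]
  rw [mul_comm Complex.I, Complex.norm_exp_ofReal_mul_I, mul_one]
  exact mul_le_one₀ (hb _) (norm_nonneg _) (hb _)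

lemma beta_le (a : ℝ) (k : ℕ) (G : ℝ → ℂ) (hG : Measurable G) (hb : ∀ t, ‖G t‖ ≤ 1) :
    ∫⁻ p in Sk a k, ‖G p.1 * G p.2‖ₑ ≤ (∫⁻ t, ‖G t‖ₑ ∂(arc a)) * ENNReal.ofReal (2 * (1 / 2) ^ k) := by
  set D : Set (ℝ × ℝ) := {p | |p.2 - p.1| ≤ (1 / 2) ^ k} with hD
  have hDm : MeasurableSet D := measurableSet_le (by fun_prop) (by fun_prop)
  set g : ℝ → ℝ≥0∞ := (Ioc a (a + 1)).indicator (fun t => ‖G t‖ₑ) with hg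
  have hgm : Measurable g := Measurable.indicator (by fun_prop) measurableSet_Ioc
  have hDi : Measurable (D.indicator (1 : ℝ × ℝ → ℝ≥0∞)) := measurable_one.indicator hDm
  calc _ ≤ ∫⁻ p : ℝ × ℝ, g p.1 * D.indicator 1 p := by
        rw [← lintegral_indicator (Sk_meas a k)]
        refine lintegral_mono fun p => ?_
        by_cases hp : p ∈ Sk a k
        · have h2 : p ∈ D := hp.2.2
          rw [indicator_of_mem hp, indicator_of_mem h2, hg, indicator_of_mem hp.1.1, enorm_mul]
          gcongr
          rw [Pi.one_apply, ← ofReal_norm]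
          exact (ENNReal.ofReal_le_ofReal (hb p.2)).trans (by simp)
        · rw [indicator_of_notMem hp]; exact zero_le
    _ = ∫⁻ x : ℝ, g x * ENNReal.ofReal (2 * (1 / 2) ^ k) := by
        rw [Measure.volume_eq_prod, lintegral_prod _ (by fun_prop)]
        congr 1; ext x
        dsimp only
        rw [lintegral_const_mul _ (by fun_prop)]
        congr 1
        have : (fun y => D.indicator (1 : ℝ × ℝ → ℝ≥0∞) (x, y)) = (Icc (x - (1/2)^k) (x + (1/2)^k)).indicator 1 := by
          ext y
          have : (x, y) ∈ D ↔ y ∈ Icc (x - (1/2)^k) (x + (1/2)^k) := by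
            simp only [hD, mem_ofPred_eq, abs_le, mem_Icc]
            constructor <;> rintro ⟨h1, h2⟩ <;> constructor <;> linarith
          by_cases h : (x, y) ∈ D
          · rw [indicator_of_mem h, indicator_of_mem (this.1 h)]; rfl
          · rw [indicator_of_notMem h, indicator_of_notMem (fun h' => h (this.2 h'))]
        rw [this, lintegral_indicator_one measurableSet_Icc, Real.volume_Icc]
        congr 1; ring
    _ = _ := by
        rw [lintegral_mul_const _ hgm, hg, lintegral_indicator measurableSet_Ioc]; rfl

lemma suptrick (P η : ℝ) (hP : 0 < P) (hη : 0 < η) : ∃ C : ℝ≥0∞, C ≠ ⊤ ∧ ∀ x : ℕ → ℝ≥0∞,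
    (∑' k, x k) ^ P ≤ C * ∑' k, ENNReal.ofReal (((2:ℝ) ^ η) ^ k) * x k ^ P := by
  refine ⟨(∑' k : ℕ, ENNReal.ofReal (1 * ((2:ℝ) ^ (-η / P)) ^ k)) ^ P, ?_, ?_⟩
  · refine ENNReal.rpow_ne_top_of_nonneg hP.le (tsum_geo _ _ (by positivity) (by positivity) ?_)
    exact Real.rpow_lt_one_of_one_lt_of_neg (by norm_num) (div_neg_of_neg_of_pos (by linarith) hP)
  intro x
  set S := ∑' k, ENNReal.ofReal (((2:ℝ) ^ η) ^ k) * x k ^ P with hS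
  have h1 : ∀ k, x k ≤ ENNReal.ofReal (1 * ((2:ℝ) ^ (-η / P)) ^ k) * S ^ (1 / P) := by
    intro k
    have h2 : ENNReal.ofReal (((2:ℝ) ^ η) ^ k) * x k ^ P ≤ S := ENNReal.le_tsum k
    have h3 : x k ^ P ≤ (ENNReal.ofReal (1 * ((2:ℝ) ^ (-η / P)) ^ k) * S ^ (1 / P)) ^ P := by
      rw [ENNReal.mul_rpow_of_nonneg _ _ hP.le, ← ENNReal.rpow_mul, one_div_mul_cancel hP.ne', ENNReal.rpow_one,
        ENNReal.ofReal_rpow_of_nonneg (by positivity) hP.le]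
      calc x k ^ P = ENNReal.ofReal ((1 * ((2:ℝ) ^ (-η / P)) ^ k) ^ P) * (ENNReal.ofReal (((2:ℝ) ^ η) ^ k) * x k ^ P) := by
            rw [← mul_assoc, ← ENNReal.ofReal_mul (by positivity)]
            have : (1 * ((2:ℝ) ^ (-η / P)) ^ k) ^ P * ((2:ℝ) ^ η) ^ k = 1 := by
              rw [one_mul, ← Real.rpow_natCast, ← Real.rpow_natCast, ← Real.rpow_mul (by positivity), ← Real.rpow_mul (by norm_num),
                ← Real.rpow_mul (by norm_num), ← Real.rpow_add (by norm_num)]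
              rw [show -η / P * (k * P) + η * k = 0 by field_simp; ring, Real.rpow_zero]
            rw [this]; simp
        _ ≤ _ := by gcongr
    exact (ENNReal.rpow_le_rpow_iff hP).1 h3
  calc _ ≤ ((∑' k : ℕ, ENNReal.ofReal (1 * ((2:ℝ) ^ (-η / P)) ^ k)) * S ^ (1 / P)) ^ P := by
        gcongr
        rw [← ENNReal.tsum_mul_right]
        exact ENNReal.tsum_le_tsum h1
    _ = _ := by
        rw [ENNReal.mul_rpow_of_nonneg _ _ hP.le, ← ENNReal.rpow_mul, one_div_mul_cancel hP.ne', ENNReal.rpow_one]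

lemma fact4 (P : ℝ) (hP : 2 < P) : ∃ C : ℝ≥0∞, C ≠ ⊤ ∧ ∀ (a : ℝ) (G : ℝ → ℂ), Measurable G →
    (∀ t, ‖G t‖ ≤ 1) →
    ∫⁻ z : ℝ × ℝ, ‖Tm (arc a) Real.cos Real.sin G z‖ₑ ^ (2 * P) ≤ C * (∫⁻ t, ‖G t‖ₑ ∂(arc a)) ^ (P - 1) := by
  set η : ℝ := (P - 2) / 2 with hη
  have hη0 : 0 < η := by rw [hη]; linarith
  obtain ⟨C0, hC0, hsup⟩ := suptrick P η (by linarith) hη0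
  refine ⟨C0 * ∑' k : ℕ, ENNReal.ofReal ((1600 * 2 ^ (P - 1)) * ((2:ℝ) ^ (-η)) ^ k),
    ENNReal.mul_ne_top hC0 (tsum_geo _ _ (by positivity) (by positivity)
      (Real.rpow_lt_one_of_one_lt_of_neg (by norm_num) (by linarith))), ?_⟩
  intro a G hG hb
  set m := ∫⁻ t, ‖G t‖ₑ ∂(arc a) with hm
  set B : ℕ → ℝ × ℝ → ℂ := fun k => Tm (volume.restrict (Sk a k)) (fun p => Real.cos p.1 + Real.cos p.2)
      (fun p => Real.sin p.1 + Real.sin p.2) (fun p => G p.1 * G p.2) with hB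
  have hBm : ∀ k, Measurable (B k) := fun k => Tm_meas _ _ _ (by fun_prop) (by fun_prop) _ (by fun_prop)
  have hBk : ∀ k, ∫⁻ z, ‖B k z‖ₑ ^ P ≤ ENNReal.ofReal (1600 * 2 ^ k * (2 * (1 / 2) ^ k) ^ (P - 1)) * m ^ (P - 1) := by
    intro k
    set β := ∫⁻ p in Sk a k, ‖G p.1 * G p.2‖ₑ with hβ
    have h1 : ∀ z, ‖B k z‖ₑ ^ P ≤ β ^ (P - 2) * ‖B k z‖ₑ ^ 2 := by
      intro z
      have : ‖B k z‖ₑ ^ P = ‖B k z‖ₑ ^ (P - 2) * ‖B k z‖ₑ ^ 2 := by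
        rw [← ENNReal.rpow_natCast, ← ENNReal.rpow_add_of_nonneg _ _ (by linarith) (by positivity)]
        congr 1; push_cast; ring
      rw [this]
      gcongr
      exact Tm_le _ _ _ _ z
    have h2 : ∫⁻ z, ‖B k z‖ₑ ^ 2 ≤ ENNReal.ofReal (1600 * 2 ^ k) * β := by
      have := bilL2 a ((1 / 2) ^ (k + 1)) (by positivity) (Sk a k) (Sk_meas a k)
        (fun p hp => ⟨hp.1.1, hp.1.2, hp.2.1.le⟩) (fun p => G p.1 * G p.2) (by fun_prop)
        (fun t => by rw [norm_mul]; exact mul_le_one₀ (hb _) (norm_nonneg _) (hb _))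
      convert! this using 3
      rw [one_div, inv_pow, div_inv_eq_mul, pow_succ]; ring
    calc _ ≤ ∫⁻ z, β ^ (P - 2) * ‖B k z‖ₑ ^ 2 := lintegral_mono h1
      _ = β ^ (P - 2) * ∫⁻ z, ‖B k z‖ₑ ^ 2 := by
          rw [lintegral_const_mul _ (by have := hBm k; fun_prop)]
      _ ≤ β ^ (P - 2) * (ENNReal.ofReal (1600 * 2 ^ k) * β) := by gcongr
      _ = ENNReal.ofReal (1600 * 2 ^ k) * β ^ (P - 1) := by
          have : β ^ (P - 1) = β ^ (P - 2) * β := by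
            conv_rhs => rw [← ENNReal.rpow_one β, ← ENNReal.rpow_mul, ← ENNReal.rpow_add_of_nonneg _ _ (by linarith) (by linarith)]
            congr 1; ring
          rw [this]; ring
      _ ≤ ENNReal.ofReal (1600 * 2 ^ k) * (m * ENNReal.ofReal (2 * (1 / 2) ^ k)) ^ (P - 1) := by
          gcongr
          · linarith
          · exact beta_le a k G hG hb
      _ = _ := by
          rw [ENNReal.mul_rpow_of_nonneg _ _ (by linarith), ENNReal.ofReal_rpow_of_nonneg (by positivity) (by linarith),
            ENNReal.ofReal_mul (p := 1600 * 2 ^ k) (by positivity)]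
          ring
  calc _ ≤ ∫⁻ z, C0 * ∑' k, ENNReal.ofReal (((2:ℝ) ^ η) ^ k) * ‖B k z‖ₑ ^ P := by
        refine lintegral_mono fun z => ?_
        rw [ENNReal.rpow_mul]
        refine le_trans ?_ (hsup _)
        have hs := sq_hasSum a G hG hb z
        gcongr
        rw [ENNReal.rpow_two, ← enorm_pow, ← hs.tsum_eq]
        exact enorm_tsum_le_tsum_enorm
    _ = C0 * ∑' k, ENNReal.ofReal (((2:ℝ) ^ η) ^ k) * ∫⁻ z, ‖B k z‖ₑ ^ P := by
        rw [lintegral_const_mul _ (Measurable.tsum fun k => by have := hBm k; fun_prop), lintegral_tsum (fun k => by have := hBm k; fun_prop)]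
        congr 2; ext k
        rw [lintegral_const_mul _ (by have := hBm k; fun_prop)]
    _ ≤ C0 * ∑' k : ℕ, ENNReal.ofReal (((2:ℝ) ^ η) ^ k) * (ENNReal.ofReal (1600 * 2 ^ k * (2 * (1 / 2) ^ k) ^ (P - 1)) * m ^ (P - 1)) := by
        gcongr with k
        exact hBk k
    _ = _ := by
        rw [mul_assoc, ← ENNReal.tsum_mul_right]
        congr 2; ext k
        rw [← mul_assoc, ← ENNReal.ofReal_mul (by positivity)]
        congr 2
        rw [Real.mul_rpow (by norm_num) (by positivity)]
        have e1 : ((1 / 2 : ℝ) ^ k) ^ (P - 1) = ((2:ℝ) ^ (-(P - 1))) ^ k := by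
          rw [one_div, inv_pow, Real.inv_rpow (by positivity), ← Real.rpow_natCast, ← Real.rpow_mul (by norm_num), ← Real.rpow_neg (by norm_num),
            ← Real.rpow_natCast, ← Real.rpow_mul (by norm_num)]
          congr 1; ring
        have e2 : (2:ℝ) ^ (-η) = 2 ^ η * 2 * 2 ^ (-(P - 1)) := by
          rw [← Real.rpow_add_one (by norm_num), ← Real.rpow_add (by norm_num)]
          congr 1; rw [hη]; ring
        rw [e1, e2, mul_pow, mul_pow]
        ring

/-- The weight `(1+|x|+|y|)^{-s}`. -/
def wt (s : ℝ) (z : ℝ × ℝ) : ℝ≥0∞ := ENNReal.ofReal ((1 + |z.1| + |z.2|) ^ (-s))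

lemma wt_meas (s : ℝ) : Measurable (wt s) := by unfold wt; fun_prop

lemma wt_base (z : ℝ × ℝ) : 1 ≤ 1 + |z.1| + |z.2| := by
  linarith [abs_nonneg z.1, abs_nonneg z.2]

lemma wt_mono {s t : ℝ} (h : t ≤ s) (z : ℝ × ℝ) : wt s z ≤ wt t z := by
  unfold wt
  apply ENNReal.ofReal_le_ofReal
  exact Real.rpow_le_rpow_of_exponent_le (wt_base z) (by linarith)

lemma wt_rpow (s a : ℝ) (ha : 0 ≤ a) (z : ℝ × ℝ) : wt s z ^ a = wt (s * a) z := by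
  unfold wt
  have := wt_base z
  rw [ENNReal.ofReal_rpow_of_nonneg (by positivity) ha, ← Real.rpow_mul (by positivity), neg_mul]

lemma wt_mul (s t : ℝ) (z : ℝ × ℝ) : wt s z * wt t z = wt (s + t) z := by
  unfold wt
  have := wt_base z
  rw [← ENNReal.ofReal_mul (by positivity), ← Real.rpow_add (by positivity)]
  congr 2; ring

lemma wt_int (s : ℝ) (hs : 2 < s) : ∫⁻ z, wt s z ≠ ⊤ := by
  have h := finite_integral_one_add_norm (E := ℝ × ℝ) (μ := volume) (r := s) (by simpa using by norm_num; linarith)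
  refine ne_top_of_le_ne_top h.ne (lintegral_mono fun z => ?_)
  unfold wt
  apply ENNReal.ofReal_le_ofReal
  apply Real.rpow_le_rpow_of_nonpos (by positivity) _ (by linarith)
  rw [Prod.norm_def, Real.norm_eq_abs, Real.norm_eq_abs]
  have := abs_nonneg z.1
  have := abs_nonneg z.2
  rcases max_cases |z.1| |z.2| with h | h <;> linarith

lemma core2 (γ q a b P ε : ℝ) (ha : 0 ≤ a) (hb : 0 ≤ b) (hab : a + b = 1) (hP : 2 < P) (hε : 0 < ε)
    (h1 : 2 * a + 2 * P * b ≤ q) (h2 : (1 + ε) * a ≤ γ * q) :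
    ∃ C : ℝ≥0∞, C ≠ ⊤ ∧ ∀ (x : ℝ) (G : ℝ → ℂ), Measurable G → (∀ t, ‖G t‖ ≤ 1) →
    ∫⁻ z, ‖Tm (arc x) Real.cos Real.sin G z‖ₑ ^ q * wt (γ * q) z ≤
      C * (∫⁻ t, ‖G t‖ₑ ∂(arc x)) ^ (q - a - b * (P + 1)) := by
  obtain ⟨C2, hC2, f2⟩ := fact2 ε hε
  obtain ⟨C4, hC4, f4⟩ := fact4 P hP
  refine ⟨C2 ^ a * C4 ^ b, ENNReal.mul_ne_top (ENNReal.rpow_ne_top_of_nonneg ha hC2)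
    (ENNReal.rpow_ne_top_of_nonneg hb hC4), ?_⟩
  intro x G hG hGb
  have hm := Tm_meas (arc x) _ _ Real.measurable_cos Real.measurable_sin G hG
  have hw := wt_meas (1 + ε)
  set T := Tm (arc x) Real.cos Real.sin G with hT
  set m := ∫⁻ t, ‖G t‖ₑ ∂(arc x) with hmm
  have hs : 0 ≤ q - 2 * a - 2 * P * b := by linarith
  have hPb : 0 ≤ P * b := by positivity
  calc _ ≤ ∫⁻ z, m ^ (q - 2 * a - 2 * P * b) * ((‖T z‖ₑ ^ 2 * wt (1 + ε) z) ^ a * (‖T z‖ₑ ^ (2 * P)) ^ b) := by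
        refine lintegral_mono fun z => ?_
        have e1 : ‖T z‖ₑ ^ q = ‖T z‖ₑ ^ (q - 2 * a - 2 * P * b) * (‖T z‖ₑ ^ (2 * a) * ‖T z‖ₑ ^ (2 * P * b)) := by
          rw [← ENNReal.rpow_add_of_nonneg _ _ (by positivity) (by positivity), ← ENNReal.rpow_add_of_nonneg _ _ hs (by positivity)]
          congr 1; ring
        rw [e1, ENNReal.mul_rpow_of_nonneg _ _ ha, wt_rpow _ _ ha, ← ENNReal.rpow_two, ← ENNReal.rpow_mul, ← ENNReal.rpow_mul]
        calc _ ≤ m ^ (q - 2 * a - 2 * P * b) * (‖T z‖ₑ ^ (2 * a) * ‖T z‖ₑ ^ (2 * P * b)) * wt ((1 + ε) * a) z := by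
              gcongr
              · exact Tm_le _ _ _ _ z
              · exact wt_mono h2 z
          _ = _ := by ring
    _ = m ^ (q - 2 * a - 2 * P * b) * ∫⁻ z, ((‖T z‖ₑ ^ 2 * wt (1 + ε) z) ^ a * (‖T z‖ₑ ^ (2 * P)) ^ b) := by
        rw [lintegral_const_mul _ (by fun_prop)]
    _ ≤ m ^ (q - 2 * a - 2 * P * b) * ((∫⁻ z, ‖T z‖ₑ ^ 2 * wt (1 + ε) z) ^ a * (∫⁻ z, ‖T z‖ₑ ^ (2 * P)) ^ b) := by
        gcongr
        exact ENNReal.lintegral_mul_norm_pow_le (by fun_prop) (by fun_prop) ha hb hab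
    _ ≤ m ^ (q - 2 * a - 2 * P * b) * ((C2 * m) ^ a * (C4 * m ^ (P - 1)) ^ b) := by
        gcongr
        · exact f2 x G hG hGb
        · exact f4 x G hG hGb
    _ = _ := by
        rw [ENNReal.mul_rpow_of_nonneg _ _ ha, ENNReal.mul_rpow_of_nonneg _ _ hb, ← ENNReal.rpow_mul]
        have : q - a - b * (P + 1) = (q - 2 * a - 2 * P * b) + (a + (P - 1) * b) := by ring
        have hP1 : 0 ≤ (P - 1) * b := mul_nonneg (by linarith) hb
        rw [this, ENNReal.rpow_add_of_nonneg _ _ hs (by positivity), ENNReal.rpow_add_of_nonneg _ _ ha hP1]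
        ring

lemma core3 (γ q a ε : ℝ) (ha : 0 ≤ a) (ha1 : a ≤ 1) (hε : 0 < ε)
    (h1 : 2 * a ≤ q) (h2 : (1 + ε) * a + (2 + ε) * (1 - a) ≤ γ * q) :
    ∃ C : ℝ≥0∞, C ≠ ⊤ ∧ ∀ (x : ℝ) (G : ℝ → ℂ), Measurable G → (∀ t, ‖G t‖ ≤ 1) →
    ∫⁻ z, ‖Tm (arc x) Real.cos Real.sin G z‖ₑ ^ q * wt (γ * q) z ≤
      C * (∫⁻ t, ‖G t‖ₑ ∂(arc x)) ^ (q - a) := by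
  obtain ⟨C2, hC2, f2⟩ := fact2 ε hε
  have hb : 0 ≤ 1 - a := by linarith
  refine ⟨C2 ^ a * (∫⁻ z, wt (2 + ε) z) ^ (1 - a), ENNReal.mul_ne_top (ENNReal.rpow_ne_top_of_nonneg ha hC2)
    (ENNReal.rpow_ne_top_of_nonneg hb (wt_int _ (by linarith))), ?_⟩
  intro x G hG hGb
  have hm := Tm_meas (arc x) _ _ Real.measurable_cos Real.measurable_sin G hG
  have hw := wt_meas (1 + ε)
  have hw2 := wt_meas (2 + ε)
  set T := Tm (arc x) Real.cos Real.sin G with hT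
  set m := ∫⁻ t, ‖G t‖ₑ ∂(arc x) with hmm
  have hs : 0 ≤ q - 2 * a := by linarith
  calc _ ≤ ∫⁻ z, m ^ (q - 2 * a) * ((‖T z‖ₑ ^ 2 * wt (1 + ε) z) ^ a * (wt (2 + ε) z) ^ (1 - a)) := by
        refine lintegral_mono fun z => ?_
        have e1 : ‖T z‖ₑ ^ q = ‖T z‖ₑ ^ (q - 2 * a) * ‖T z‖ₑ ^ (2 * a) := by
          rw [← ENNReal.rpow_add_of_nonneg _ _ hs (by positivity)]
          congr 1; ring
        rw [e1, ENNReal.mul_rpow_of_nonneg _ _ ha, wt_rpow _ _ ha, wt_rpow _ _ hb, ← ENNReal.rpow_two, ← ENNReal.rpow_mul, mul_assoc (_ ^ (2 * a)), wt_mul, mul_assoc]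
        gcongr
        · exact Tm_le _ _ _ _ z
        · exact wt_mono h2 z
    _ = m ^ (q - 2 * a) * ∫⁻ z, ((‖T z‖ₑ ^ 2 * wt (1 + ε) z) ^ a * (wt (2 + ε) z) ^ (1 - a)) := by
        rw [lintegral_const_mul _ (by fun_prop)]
    _ ≤ m ^ (q - 2 * a) * ((∫⁻ z, ‖T z‖ₑ ^ 2 * wt (1 + ε) z) ^ a * (∫⁻ z, wt (2 + ε) z) ^ (1 - a)) := by
        gcongr
        exact ENNReal.lintegral_mul_norm_pow_le (by fun_prop) (by fun_prop) ha hb (by ring)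
    _ ≤ m ^ (q - 2 * a) * ((C2 * m) ^ a * (∫⁻ z, wt (2 + ε) z) ^ (1 - a)) := by
        gcongr
        exact f2 x G hG hGb
    _ = _ := by
        rw [ENNReal.mul_rpow_of_nonneg _ _ ha]
        have : q - a = (q - 2 * a) + a := by ring
        rw [this, ENNReal.rpow_add_of_nonneg _ _ hs ha]
        ring

lemma core (γ q v : ℝ) (hγ : 0 ≤ γ) (hq : 0 < q) (hv : 0 < v)
    (h1 : 2 - γ * q < q / 2) (h2 : 3 - 2 * (γ * q) < v * q) (h3 : 2 - γ * q < v * q) :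
    ∃ E : ℝ, q * (1 - v) < E ∧ ∃ C : ℝ≥0∞, C ≠ ⊤ ∧ ∀ (x : ℝ) (G : ℝ → ℂ), Measurable G → (∀ t, ‖G t‖ ≤ 1) →
    ∫⁻ z, ‖Tm (arc x) Real.cos Real.sin G z‖ₑ ^ q * wt (γ * q) z ≤
      C * (∫⁻ t, ‖G t‖ₑ ∂(arc x)) ^ E := by
  have hvq : 0 < v * q := by positivity
  have hγq : 0 ≤ γ * q := by positivity
  by_cases hT : 2 - γ * q < 1
  · obtain ⟨a, ha0, ha1, haT, hav, haq⟩ : ∃ a : ℝ, 0 ≤ a ∧ a ≤ 1 ∧ 2 - γ * q < a ∧ a < v * q ∧ 2 * a ≤ q := by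
      by_cases h0 : 2 - γ * q < 0
      · exact ⟨0, le_rfl, by norm_num, h0, hvq, by linarith⟩
      · obtain ⟨a, l, u⟩ := exists_between (lt_min (lt_min hT h3) h1)
        simp only [lt_min_iff] at u
        exact ⟨a, by linarith, by linarith, l, u.1.2, by linarith⟩
    refine ⟨q - a, by linarith, core3 γ q a (a - (2 - γ * q)) ha0 ha1 (by linarith) haq (by nlinarith)⟩
  · obtain ⟨s, hs1, hs2, hsq, hsv, ε, hε, hsε⟩ : ∃ s : ℝ, 1 ≤ s ∧ s ≤ 2 ∧ 2 * s < q ∧ 2 * s - 1 < v * q ∧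
        ∃ ε : ℝ, 0 < ε ∧ (1 + ε) * (2 - s) ≤ γ * q := by
      by_cases h0 : γ * q = 0
      · exact ⟨2, by norm_num, le_rfl, by linarith, by linarith, 1, by norm_num, by linarith⟩
      · have h0' : 0 < γ * q := lt_of_le_of_ne hγq (Ne.symm h0)
        obtain ⟨s, l, u⟩ := exists_between (lt_min (lt_min (show 2 - γ * q < 2 by linarith) h1)
          (show 2 - γ * q < (v * q + 1) / 2 by linarith))
        simp only [lt_min_iff] at u
        refine ⟨s, by linarith, by linarith, by linarith, by linarith, γ * q - (2 - s), by linarith, ?_⟩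
        nlinarith
    set η := min ((q - 2 * s) / 2) ((v * q - (2 * s - 1)) / 2) with hη
    have hη0 : 0 < η := lt_min (by linarith) (by linarith)
    have hη1 : η ≤ (q - 2 * s) / 2 := min_le_left _ _
    have hη2 : η ≤ (v * q - (2 * s - 1)) / 2 := min_le_right _ _
    refine ⟨_, ?_, core2 γ q (2 - s) (s - 1) (2 + η) ε (by linarith) (by linarith) (by ring) (by linarith) hε ?_ hsε⟩
    · nlinarith
    · nlinarith

/-- Dyadic level sets. -/
def lev (F : ℝ → ℂ) : ℕ → Set ℝ := disjointed fun j => {t | ‖F t‖ ≤ 2 ^ j}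

lemma lev_meas (F : ℝ → ℂ) (hF : Measurable F) (j : ℕ) : MeasurableSet (lev F j) := by
  refine MeasurableSet.disjointed (fun i => ?_) j
  exact measurableSet_le (by fun_prop) (by fun_prop)

lemma lev_union (F : ℝ → ℂ) : ⋃ j, lev F j = univ := by
  unfold lev
  rw [iUnion_disjointed, eq_univ_iff_forall]
  intro t
  obtain ⟨n, hn⟩ := pow_unbounded_of_one_lt ‖F t‖ (one_lt_two)
  exact mem_iUnion.2 ⟨n, hn.le⟩

lemma lev_upper (F : ℝ → ℂ) (j : ℕ) (t : ℝ) (ht : t ∈ lev F j) : ‖F t‖ ≤ 2 ^ j :=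
  disjointed_subset (fun j : ℕ => {t | ‖F t‖ ≤ 2 ^ j}) j ht

lemma lev_lower (F : ℝ → ℂ) (j : ℕ) (t : ℝ) (ht : t ∈ lev F (j + 1)) : 2 ^ j < ‖F t‖ := by
  by_contra! h
  have hmono : Monotone (fun j : ℕ => {t | ‖F t‖ ≤ (2:ℝ) ^ j}) := by
    intro i k hik t ht
    have : ‖F t‖ ≤ (2:ℝ) ^ i := ht
    exact this.trans (pow_le_pow_right₀ one_le_two hik)
  unfold lev at ht
  rw [hmono.disjointed_add_one] at ht
  exact ht.2 h

/-- Normalized dyadic pieces. -/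
def pc (F : ℝ → ℂ) (j : ℕ) (t : ℝ) : ℂ := ((2:ℂ) ^ j)⁻¹ * (lev F j).indicator F t

lemma pc_meas (F : ℝ → ℂ) (hF : Measurable F) (j : ℕ) : Measurable (pc F j) := by
  unfold pc
  exact (hF.indicator (lev_meas F hF j)).const_mul _

lemma pc_le_one (F : ℝ → ℂ) (j : ℕ) (t : ℝ) : ‖pc F j t‖ ≤ 1 := by
  unfold pc
  rw [norm_mul, norm_inv, norm_pow, Complex.norm_ofNat, inv_mul_le_iff₀ (by positivity), mul_one]
  by_cases h : t ∈ lev F j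
  · rw [indicator_of_mem h]; exact lev_upper F j t h
  · rw [indicator_of_notMem h]; simp

lemma pc_mass (F : ℝ → ℂ) (r : ℝ) (hr : 1 < r) (j : ℕ) (t : ℝ) :
    ‖pc F j t‖ₑ ≤ ENNReal.ofReal (2 ^ r * ((2:ℝ) ^ (-r)) ^ j) * (1 + ‖F t‖ₑ ^ r) := by
  have hone : ‖pc F j t‖ₑ ≤ 1 := by
    rw [← ofReal_norm]
    exact (ENNReal.ofReal_le_ofReal (pc_le_one F j t)).trans (by simp)
  by_cases h : t ∈ lev F j
  · refine hone.trans ?_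
    rcases j with _ | j
    · have : (1:ℝ) ≤ 2 ^ r := Real.one_le_rpow one_le_two (by linarith)
      calc (1:ℝ≥0∞) = 1 * 1 := by simp
        _ ≤ _ := by
          refine mul_le_mul' ?_ le_self_add
          rw [pow_zero, mul_one]; simpa using this
    · have := lev_lower F j t h
      rw [← ofReal_norm, ENNReal.ofReal_rpow_of_nonneg (norm_nonneg _) (by linarith)]
      refine le_trans ?_ (mul_le_mul_right le_add_self _)
      rw [← ENNReal.ofReal_mul (by positivity)]
      rw [show (1:ℝ≥0∞) = ENNReal.ofReal 1 by simp]
      apply ENNReal.ofReal_le_ofReal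
      have h2 : ((2:ℝ) ^ j) ^ r ≤ ‖F t‖ ^ r := by gcongr
      calc (1:ℝ) = 2 ^ r * ((2:ℝ) ^ (-r)) ^ (j + 1) * ((2:ℝ) ^ j) ^ r := by
            rw [← Real.rpow_natCast, ← Real.rpow_natCast, ← Real.rpow_mul (by norm_num), ← Real.rpow_mul (by norm_num),
              ← Real.rpow_add (by norm_num), ← Real.rpow_add (by norm_num)]
            push_cast
            rw [show r + -r * (j + 1) + j * r = 0 by ring, Real.rpow_zero]
        _ ≤ _ := by gcongr
  · unfold pc
    rw [indicator_of_notMem h]; simp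

lemma Tm_hasSum (x : ℝ) (F : ℝ → ℂ) (hF : Measurable F) (hi : Integrable F (arc x)) (z : ℝ × ℝ) :
    HasSum (fun j : ℕ => (2:ℂ) ^ j * Tm (arc x) Real.cos Real.sin (pc F j) z) (Tm (arc x) Real.cos Real.sin F z) := by
  set K : ℝ → ℂ := fun t => F t * Complex.exp (Complex.I * Complex.ofReal (z.1 * Real.cos t + z.2 * Real.sin t)) with hK
  have hKi : Integrable K (arc x) := by
    refine hi.mono (Measurable.aestronglyMeasurable (by fun_prop)) (ae_of_all _ fun t => ?_)
    simp only [hK, norm_mul]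
    rw [mul_comm Complex.I, Complex.norm_exp_ofReal_mul_I, mul_one]
  have h := hasSum_integral_iUnion (μ := arc x) (f := K) (s := lev F) (lev_meas F hF)
    (disjoint_disjointed _) (by rw [lev_union]; exact hKi.integrableOn)
  rw [lev_union, setIntegral_univ] at h
  convert! h using 1
  ext j
  unfold Tm
  rw [← integral_const_mul, ← integral_indicator (lev_meas F hF j)]
  congr 1; ext t
  unfold pc
  by_cases ht : t ∈ lev F j
  · rw [indicator_of_mem ht, indicator_of_mem ht, hK, ← mul_assoc, ← mul_assoc, mul_inv_cancel₀ (by simp), one_mul]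
  · rw [indicator_of_notMem ht, indicator_of_notMem ht]; simp

lemma normalized (γ q r : ℝ) (hγ : 0 ≤ γ) (hq : 0 < q) (hr : 1 < r)
    (h1 : 2 - γ * q < q / 2) (h2 : 3 - 2 * (γ * q) < (1 - 1 / r) * q) (h3 : 2 - γ * q < (1 - 1 / r) * q) :
    ∃ C : ℝ≥0∞, C ≠ ⊤ ∧ ∀ (x : ℝ) (F : ℝ → ℂ), Measurable F → ∫⁻ t, ‖F t‖ₑ ^ r ∂(arc x) ≤ 1 →
    ∫⁻ z, ‖Tm (arc x) Real.cos Real.sin F z‖ₑ ^ q * wt (γ * q) z ≤ C := by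
  have hr0 : 0 < r := by linarith
  obtain ⟨E, hE, C, hC, hcore⟩ := core γ q (1 - 1 / r) hγ hq
    (by have : 1 / r < 1 := by rw [div_lt_one hr0]; exact hr
        linarith) h1 h2 h3
  have hE' : q < r * E := by
    have : q * (1 - (1 - 1 / r)) = q / r := by ring
    rw [this, div_lt_iff₀ hr0] at hE
    linarith
  have hE0 : 0 < E := by
    by_contra! h
    nlinarith
  set η : ℝ := (r * E - q) / 2 with hη
  have hη0 : 0 < η := by rw [hη]; linarith
  obtain ⟨C0, hC0, hsup⟩ := suptrick q η hq hη0
  refine ⟨C0 * (C * ∑' j : ℕ, ENNReal.ofReal ((2 ^ (r + 1)) ^ E * ((2:ℝ) ^ (-η)) ^ j)),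
    ENNReal.mul_ne_top hC0 (ENNReal.mul_ne_top hC (tsum_geo _ _ (by positivity) (by positivity)
      (Real.rpow_lt_one_of_one_lt_of_neg (by norm_num) (by linarith)))), ?_⟩
  intro x F hF hN
  have harc : (arc x) univ = 1 := by
    unfold arc; simp
  have hi : Integrable F (arc x) := by
    refine ⟨hF.aestronglyMeasurable, ?_⟩
    refine lt_of_le_of_lt (b := ∫⁻ t, (1 + ‖F t‖ₑ ^ r) ∂(arc x)) (lintegral_mono fun t => ?_) ?_
    · rcases le_total ‖F t‖ₑ 1 with h | h
      · exact h.trans le_self_add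
      · refine le_trans ?_ le_add_self
        conv_lhs => rw [← ENNReal.rpow_one ‖F t‖ₑ]
        exact ENNReal.rpow_le_rpow_of_exponent_le h hr.le
    · rw [lintegral_add_left (by fun_prop), lintegral_const, harc]
      exact lt_of_le_of_lt (add_le_add le_rfl hN) (by norm_num)
  have hmass : ∀ j, ∫⁻ t, ‖pc F j t‖ₑ ∂(arc x) ≤ ENNReal.ofReal (2 ^ (r + 1) * ((2:ℝ) ^ (-r)) ^ j) := by
    intro j
    calc _ ≤ ∫⁻ t, ENNReal.ofReal (2 ^ r * ((2:ℝ) ^ (-r)) ^ j) * (1 + ‖F t‖ₑ ^ r) ∂(arc x) :=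
          lintegral_mono fun t => pc_mass F r hr j t
      _ = ENNReal.ofReal (2 ^ r * ((2:ℝ) ^ (-r)) ^ j) * (1 + ∫⁻ t, ‖F t‖ₑ ^ r ∂(arc x)) := by
          rw [lintegral_const_mul _ (by fun_prop), lintegral_add_left (by fun_prop), lintegral_const, harc, one_mul]
      _ ≤ ENNReal.ofReal (2 ^ r * ((2:ℝ) ^ (-r)) ^ j) * (1 + 1) := by gcongr
      _ = _ := by
          rw [show (1 + 1 : ℝ≥0∞) = ENNReal.ofReal 2 by norm_num, ← ENNReal.ofReal_mul (by positivity),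
            Real.rpow_add_one (by norm_num)]
          congr 1; ring
  have hTm : ∀ j, Measurable (Tm (arc x) Real.cos Real.sin (pc F j)) := fun j =>
    Tm_meas _ _ _ Real.measurable_cos Real.measurable_sin _ (pc_meas F hF j)
  have hw := wt_meas (γ * q)
  calc _ ≤ ∫⁻ z, C0 * ∑' j : ℕ, ENNReal.ofReal (((2:ℝ) ^ η) ^ j * ((2:ℝ) ^ q) ^ j) *
        (‖Tm (arc x) Real.cos Real.sin (pc F j) z‖ₑ ^ q * wt (γ * q) z) := by
        refine lintegral_mono fun z => ?_
        have hs := Tm_hasSum x F hF hi z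
        calc _ ≤ (∑' j : ℕ, ‖(2:ℂ) ^ j * Tm (arc x) Real.cos Real.sin (pc F j) z‖ₑ) ^ q * wt (γ * q) z := by
              gcongr
              rw [← hs.tsum_eq]
              exact enorm_tsum_le_tsum_enorm
          _ ≤ (C0 * ∑' j : ℕ, ENNReal.ofReal (((2:ℝ) ^ η) ^ j) * ‖(2:ℂ) ^ j * Tm (arc x) Real.cos Real.sin (pc F j) z‖ₑ ^ q) * wt (γ * q) z := by
              gcongr
              exact hsup _
          _ = _ := by
              rw [mul_assoc, ← ENNReal.tsum_mul_right]
              congr 2; ext j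
              rw [enorm_mul, ENNReal.mul_rpow_of_nonneg _ _ hq.le, ← ofReal_norm ((2:ℂ) ^ j), norm_pow, Complex.norm_ofNat,
                ENNReal.ofReal_rpow_of_nonneg (by positivity) hq.le, ENNReal.ofReal_mul (by positivity)]
              have : ((2:ℝ) ^ j) ^ q = ((2:ℝ) ^ q) ^ j := by
                rw [← Real.rpow_natCast, ← Real.rpow_natCast, ← Real.rpow_mul (by norm_num), ← Real.rpow_mul (by norm_num), mul_comm]
              rw [this]; ring
    _ = C0 * ∑' j : ℕ, ENNReal.ofReal (((2:ℝ) ^ η) ^ j * ((2:ℝ) ^ q) ^ j) *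
        ∫⁻ z, (‖Tm (arc x) Real.cos Real.sin (pc F j) z‖ₑ ^ q * wt (γ * q) z) := by
        rw [lintegral_const_mul _ (Measurable.tsum fun j => by have := hTm j; fun_prop), lintegral_tsum (fun j => by have := hTm j; fun_prop)]
        congr 2; ext j
        rw [lintegral_const_mul _ (by have := hTm j; fun_prop)]
    _ ≤ C0 * ∑' j : ℕ, ENNReal.ofReal (((2:ℝ) ^ η) ^ j * ((2:ℝ) ^ q) ^ j) *
        (C * ENNReal.ofReal (2 ^ (r + 1) * ((2:ℝ) ^ (-r)) ^ j) ^ E) := by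
        gcongr with j
        refine (hcore x (pc F j) (pc_meas F hF j) (pc_le_one F j)).trans ?_
        gcongr
        exact hmass j
    _ = _ := by
        congr 1
        rw [← ENNReal.tsum_mul_left]
        refine tsum_congr fun j => ?_
        rw [ENNReal.ofReal_rpow_of_nonneg (by positivity) hE0.le, mul_left_comm, ← ENNReal.ofReal_mul (by positivity)]
        congr 2
        rw [Real.mul_rpow (by positivity) (by positivity)]
        have e1 : (((2:ℝ) ^ (-r)) ^ j) ^ E = ((2:ℝ) ^ (-(r * E))) ^ j := by
          rw [← Real.rpow_natCast, ← Real.rpow_natCast, ← Real.rpow_mul (by positivity), ← Real.rpow_mul (by positivity), ← Real.rpow_mul (by positivity)]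
          congr 1; ring
        have e2 : (2:ℝ) ^ (-η) = 2 ^ η * 2 ^ q * 2 ^ (-(r * E)) := by
          rw [← Real.rpow_add (by norm_num), ← Real.rpow_add (by norm_num)]
          congr 1; rw [hη]; ring
        rw [e1, e2, mul_pow, mul_pow]
        ring

lemma scaled (γ q r : ℝ) (hγ : 0 ≤ γ) (hq : 0 < q) (hr : 1 < r)
    (h1 : 2 - γ * q < q / 2) (h2 : 3 - 2 * (γ * q) < (1 - 1 / r) * q) (h3 : 2 - γ * q < (1 - 1 / r) * q) :
    ∃ C : ℝ≥0∞, C ≠ ⊤ ∧ ∀ (x : ℝ) (F : ℝ → ℂ), Measurable F → ∫⁻ t, ‖F t‖ₑ ^ r ∂(arc x) ≠ ⊤ →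
    ∫⁻ z, ‖Tm (arc x) Real.cos Real.sin F z‖ₑ ^ q * wt (γ * q) z ≤ C * (∫⁻ t, ‖F t‖ₑ ^ r ∂(arc x)) ^ (q / r) := by
  have hr0 : 0 < r := by linarith
  obtain ⟨C, hC, hn⟩ := normalized γ q r hγ hq hr h1 h2 h3
  refine ⟨C, hC, ?_⟩
  intro x F hF hN
  set N := ∫⁻ t, ‖F t‖ₑ ^ r ∂(arc x) with hNd
  by_cases h0 : N = 0
  · have hz : ∀ᵐ t ∂(arc x), F t = 0 := by
      rw [hNd, lintegral_eq_zero_iff (by fun_prop)] at h0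
      filter_upwards [h0] with t ht
      simpa [hr0, hr0.le, hr0.not_gt] using ht
    have : ∀ z, Tm (arc x) Real.cos Real.sin F z = 0 := by
      intro z
      unfold Tm
      refine integral_eq_zero_of_ae ?_
      filter_upwards [hz] with t ht
      simp [ht]
    simp [this, hq]
  set n : ℝ := N.toReal ^ (1 / r) with hn'
  have hNpos : 0 < N.toReal := ENNReal.toReal_pos h0 hN
  have hnpos : 0 < n := by positivity
  have e1 : ENNReal.ofReal n ^ r = N := by
    rw [ENNReal.ofReal_rpow_of_nonneg hnpos.le hr0.le, hn', ← Real.rpow_mul hNpos.le, one_div_mul_cancel hr0.ne', Real.rpow_one,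
      ENNReal.ofReal_toReal hN]
  have e2 : ENNReal.ofReal n ^ q = N ^ (q / r) := by
    rw [← e1, ← ENNReal.rpow_mul]; congr 1; field_simp
  have hFn : ∀ t, ‖F t‖ₑ = ENNReal.ofReal n * ‖((n:ℂ)⁻¹ * F t)‖ₑ := by
    intro t
    rw [show ENNReal.ofReal n = ‖(n:ℂ)‖ₑ by rw [← ofReal_norm, Complex.norm_real, Real.norm_eq_abs, abs_of_pos hnpos], ← enorm_mul,
      mul_inv_cancel_left₀ (by exact_mod_cast hnpos.ne')]
  have e3 : ∫⁻ t, ‖((n:ℂ)⁻¹ * F t)‖ₑ ^ r ∂(arc x) ≤ 1 := by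
    have : N = N * ∫⁻ t, ‖((n:ℂ)⁻¹ * F t)‖ₑ ^ r ∂(arc x) := by
      conv_lhs => rw [hNd]
      simp_rw [hFn, ENNReal.mul_rpow_of_nonneg _ _ hr0.le]
      rw [lintegral_const_mul _ (by fun_prop), e1]
    rw [← ENNReal.mul_le_mul_iff_right h0 hN, ← this, mul_one]
  have h := hn x (fun t => (n:ℂ)⁻¹ * F t) (by fun_prop) e3
  have e4 : ∀ z, Tm (arc x) Real.cos Real.sin F z = n * Tm (arc x) Real.cos Real.sin (fun t => (n:ℂ)⁻¹ * F t) z := by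
    intro z
    unfold Tm
    rw [← integral_const_mul]
    congr 1; ext t
    rw [← mul_assoc, mul_inv_cancel_left₀ (by exact_mod_cast hnpos.ne')]
  have hm := Tm_meas (arc x) _ _ Real.measurable_cos Real.measurable_sin (fun t => (n:ℂ)⁻¹ * F t) (by fun_prop)
  have hw := wt_meas (γ * q)
  calc _ = N ^ (q / r) * ∫⁻ z, ‖Tm (arc x) Real.cos Real.sin (fun t => (n:ℂ)⁻¹ * F t) z‖ₑ ^ q * wt (γ * q) z := by
        rw [← lintegral_const_mul _ (by fun_prop)]
        congr 1; ext z
        rw [e4, enorm_mul, ENNReal.mul_rpow_of_nonneg _ _ hq.le, ← ofReal_norm (n:ℂ), Complex.norm_real, Real.norm_eq_abs, abs_of_pos hnpos, e2, mul_assoc]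
    _ ≤ N ^ (q / r) * C := by gcongr
    _ = _ := mul_comm _ _

lemma sum_rpow_le (x : ℕ → ℝ≥0∞) (q : ℝ) (hq : 0 < q) :
    (∑ n ∈ Finset.range 7, x n) ^ q ≤ 7 ^ q * ∑ n ∈ Finset.range 7, x n ^ q := by
  have h : ∀ n ∈ Finset.range 7, x n ≤ (∑ n ∈ Finset.range 7, x n ^ q) ^ (1 / q) := by
    intro n hn
    rw [one_div, ENNReal.le_rpow_inv_iff hq]
    exact Finset.single_le_sum (f := fun n => x n ^ q) (fun _ _ => zero_le) hn
  calc _ ≤ ((7 : ℝ≥0∞) * (∑ n ∈ Finset.range 7, x n ^ q) ^ (1 / q)) ^ q := by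
        gcongr
        refine (Finset.sum_le_card_nsmul _ _ _ h).trans ?_
        simp
    _ = _ := by
        rw [ENNReal.mul_rpow_of_nonneg _ _ hq.le, ← ENNReal.rpow_mul, one_div_mul_cancel hq.ne', ENNReal.rpow_one]

lemma Rext_eq (F : ℝ → ℂ) (hi : IntegrableOn F (Ioc 0 (2 * π))) (z : ℝ × ℝ) :
    Rext F z.1 z.2 = Complex.ofReal (1 / (2 * π)) *
      ∑ n ∈ Finset.range 7, Tm (arc n) Real.cos Real.sin ((Ioc 0 (2 * π)).indicator F) z := by
  unfold Rext
  congr 1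
  set K : ℝ → ℂ := fun φ => Complex.exp (Complex.I * Complex.ofReal (z.1 * Real.cos φ + z.2 * Real.sin φ)) with hK
  have hpi : 2 * π ≤ 7 := by have := Real.pi_lt_d2; linarith
  have hKn : ∀ φ, ‖K φ‖ ≤ 1 := by
    intro φ
    rw [hK]
    simp only
    rw [mul_comm, Complex.norm_exp_ofReal_mul_I]
  have hii : Integrable (fun φ => (Ioc 0 (2 * π)).indicator F φ * K φ) := by
    have h0 : Integrable ((Ioc 0 (2 * π)).indicator F) := (integrable_indicator_iff measurableSet_Ioc).2 hi
    refine h0.mul_bdd (c := 1) ?_ (ae_of_all _ hKn)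
    exact Continuous.aestronglyMeasurable (by fun_prop)
  have e1 : ∀ n : ℕ, Tm (arc n) Real.cos Real.sin ((Ioc 0 (2 * π)).indicator F) z =
      ∫ φ in (n : ℝ)..((n + 1 : ℕ) : ℝ), (Ioc 0 (2 * π)).indicator F φ * K φ := by
    intro n
    rw [intervalIntegral.integral_of_le (by push_cast; linarith)]
    unfold Tm arc
    rw [Nat.cast_add_one]
  simp_rw [e1]
  rw [intervalIntegral.sum_integral_adjacent_intervals (fun k _ => hii.intervalIntegrable)]
  rw [intervalIntegral.integral_of_le (by positivity), intervalIntegral.integral_of_le (by norm_num)]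
  have e2 : (fun φ => (Ioc 0 (2 * π)).indicator F φ * K φ) = (Ioc 0 (2 * π)).indicator (fun φ => F φ * K φ) := by
    ext φ
    by_cases h : φ ∈ Ioc 0 (2 * π) <;> simp [h]
  rw [e2, setIntegral_indicator measurableSet_Ioc]
  congr 2
  ext φ
  simp only [mem_Ioc, mem_inter_iff, Nat.cast_zero, Nat.cast_ofNat]
  constructor
  · rintro ⟨a, b⟩; exact ⟨⟨a, b.trans hpi⟩, a, b⟩
  · rintro ⟨_, h⟩; exact h

lemma Rgamma_rpow (γ q : ℝ) (hq : 0 < q) (F : ℝ → ℂ) (z : ℝ × ℝ) :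
    ‖Rgamma γ F z.1 z.2‖ₑ ^ q = ‖Rext F z.1 z.2‖ₑ ^ q * wt (γ * q) z := by
  unfold Rgamma
  have := wt_base z
  rw [enorm_mul, ENNReal.mul_rpow_of_nonneg _ _ hq.le, ← wt_rpow γ q hq.le]
  congr 2
  unfold wt
  rw [← ofReal_norm, Complex.norm_real, Real.norm_eq_abs, abs_of_nonneg (by positivity)]

lemma cpi_le : ‖Complex.ofReal (1 / (2 * π))‖ₑ ≤ 1 := by
  rw [← ofReal_norm, Complex.norm_real, Real.norm_eq_abs, abs_of_nonneg (by positivity)]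
  rw [← ENNReal.ofReal_one]
  apply ENNReal.ofReal_le_ofReal
  rw [div_le_one (by positivity)]
  have := Real.pi_gt_three
  linarith

lemma planeLp_eq (q : ℝ) (hq : 0 < q) (g : ℝ × ℝ → ℂ) :
    planeLp (ENNReal.ofReal q) g = (∫⁻ z, ‖g z‖ₑ ^ q) ^ (1 / q) := by
  unfold planeLp
  rw [eLpNorm_eq_lintegral_rpow_enorm_toReal (by simpa using hq) ENNReal.ofReal_ne_top, ENNReal.toReal_ofReal hq.le]

lemma circleLp_eq (r : ℝ) (hr : 0 < r) (g : ℝ → ℂ) :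
    circleLp (ENNReal.ofReal r) g = (∫⁻ z in Ioc 0 (2 * π), ‖g z‖ₑ ^ r) ^ (1 / r) := by
  unfold circleLp
  rw [eLpNorm_eq_lintegral_rpow_enorm_toReal (by simpa using hr) ENNReal.ofReal_ne_top, ENNReal.toReal_ofReal hr.le]

lemma finite_case (γ q r : ℝ) (hγ : 0 ≤ γ) (hq : 0 < q) (hr : 1 < r)
    (h1 : 2 - γ * q < q / 2) (h2 : 3 - 2 * (γ * q) < (1 - 1 / r) * q) (h3 : 2 - γ * q < (1 - 1 / r) * q) :
    ∃ C : ℝ≥0∞, C ≠ ⊤ ∧ ∀ F : ℝ → ℂ, Measurable F → circleLp (ENNReal.ofReal r) F ≠ ⊤ →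
      planeLp (ENNReal.ofReal q) (fun p => Rgamma γ F p.1 p.2) ≤ C * circleLp (ENNReal.ofReal r) F := by
  have hr0 : 0 < r := by linarith
  obtain ⟨C, hC, hs⟩ := scaled γ q r hγ hq hr h1 h2 h3
  refine ⟨(7 ^ q * (7 * C)) ^ (1 / q), ?_, ?_⟩
  · refine ENNReal.rpow_ne_top_of_nonneg (by positivity) (ENNReal.mul_ne_top ?_ (ENNReal.mul_ne_top (by norm_num) hC))
    exact ENNReal.rpow_ne_top_of_nonneg hq.le (by norm_num)
  intro F hF hN
  have hi : IntegrableOn F (Ioc 0 (2 * π)) := by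
    have : MemLp F (ENNReal.ofReal r) (volume.restrict (Ioc 0 (2 * π))) :=
      ⟨hF.aestronglyMeasurable, lt_top_iff_ne_top.2 hN⟩
    exact this.integrable (by rw [← ENNReal.ofReal_one]; exact ENNReal.ofReal_le_ofReal hr.le)
  rw [circleLp_eq r hr0] at hN ⊢
  rw [planeLp_eq q hq]
  set N := ∫⁻ z in Ioc 0 (2 * π), ‖F z‖ₑ ^ r with hNd
  have hN' : N ≠ ⊤ := by
    intro h
    rw [h, ENNReal.top_rpow_of_pos (by positivity)] at hN
    exact hN rfl
  set G := (Ioc 0 (2 * π)).indicator F with hG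
  have hGm : Measurable G := hF.indicator measurableSet_Ioc
  have hGN : ∀ n : ℕ, ∫⁻ t, ‖G t‖ₑ ^ r ∂(arc n) ≤ N := by
    intro n
    rw [hNd, ← lintegral_indicator measurableSet_Ioc]
    refine (setLIntegral_le_lintegral _ _).trans (lintegral_mono fun t => ?_)
    by_cases h : t ∈ Ioc 0 (2 * π)
    · simp [hG, h]
    · simp [hG, h, hr0]
  have hw := wt_meas (γ * q)
  have hTm : ∀ n : ℕ, Measurable (Tm (arc n) Real.cos Real.sin G) := fun n =>
    Tm_meas _ _ _ Real.measurable_cos Real.measurable_sin _ hGm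
  have key : ∫⁻ z : ℝ × ℝ, ‖Rgamma γ F z.1 z.2‖ₑ ^ q ≤ 7 ^ q * (7 * C) * N ^ (q / r) := by
    calc _ ≤ ∫⁻ z : ℝ × ℝ, 7 ^ q * ∑ n ∈ Finset.range 7, ‖Tm (arc n) Real.cos Real.sin G z‖ₑ ^ q * wt (γ * q) z := by
          refine lintegral_mono fun z => ?_
          simp only
          rw [Rgamma_rpow γ q hq, ← Finset.sum_mul, ← mul_assoc]
          gcongr
          refine le_trans ?_ (sum_rpow_le _ q hq)
          gcongr
          rw [Rext_eq F hi z, enorm_mul]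
          refine (mul_le_mul' cpi_le (enorm_sum_le _ _)).trans ?_
          rw [one_mul]
      _ = 7 ^ q * ∑ n ∈ Finset.range 7, ∫⁻ z : ℝ × ℝ, ‖Tm (arc n) Real.cos Real.sin G z‖ₑ ^ q * wt (γ * q) z := by
          rw [lintegral_const_mul _ (by fun_prop), lintegral_finsetSum _ (fun n _ => by have := hTm n; fun_prop)]
      _ ≤ 7 ^ q * ∑ n ∈ Finset.range 7, C * N ^ (q / r) := by
          gcongr with n hn
          refine (hs n G hGm (ne_top_of_le_ne_top hN' (hGN n))).trans ?_
          gcongr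
          exact hGN n
      _ = _ := by
          rw [Finset.sum_const, Finset.card_range, nsmul_eq_mul, Nat.cast_ofNat]; ring
  calc _ ≤ (7 ^ q * (7 * C) * N ^ (q / r)) ^ (1 / q) := by gcongr
    _ = _ := by
      rw [ENNReal.mul_rpow_of_nonneg _ _ (by positivity), ← ENNReal.rpow_mul]
      congr 2
      field_simp

lemma one_case (γ q : ℝ) (hq : 0 < q) (h1 : 2 < γ * q) :
    ∃ C : ℝ≥0∞, C ≠ ⊤ ∧ ∀ F : ℝ → ℂ, Measurable F →
      planeLp (ENNReal.ofReal q) (fun p => Rgamma γ F p.1 p.2) ≤ C * circleLp 1 F := by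
  refine ⟨(∫⁻ z, wt (γ * q) z) ^ (1 / q), ENNReal.rpow_ne_top_of_nonneg (by positivity) (wt_int _ h1), ?_⟩
  intro F hF
  rw [planeLp_eq q hq]
  have hw := wt_meas (γ * q)
  have hR : ∀ z : ℝ × ℝ, ‖Rext F z.1 z.2‖ₑ ≤ circleLp 1 F := by
    intro z
    unfold Rext circleLp
    rw [eLpNorm_one_eq_lintegral_enorm, enorm_mul, intervalIntegral.integral_of_le (by positivity)]
    refine (mul_le_mul' cpi_le (Tm_le (volume.restrict (Ioc 0 (2 * π))) Real.cos Real.sin F z)).trans ?_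
    rw [one_mul]
  calc _ ≤ (∫⁻ z, circleLp 1 F ^ q * wt (γ * q) z) ^ (1 / q) := by
        gcongr with z
        rw [Rgamma_rpow γ q hq]
        gcongr
        exact hR z
    _ = _ := by
        rw [lintegral_const_mul _ hw, ENNReal.mul_rpow_of_nonneg _ _ (by positivity), ← ENNReal.rpow_mul,
          mul_one_div_cancel hq.ne', ENNReal.rpow_one, mul_comm]

lemma top_case (γ q : ℝ) (hγ : 0 ≤ γ) (hq : 0 < q)
    (h1 : 2 - γ * q < q / 2) (h2 : 3 - 2 * (γ * q) < q) (h3 : 2 - γ * q < q) :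
    ∃ C : ℝ≥0∞, C ≠ ⊤ ∧ ∀ F : ℝ → ℂ, Measurable F → circleLp ⊤ F ≠ ⊤ →
      planeLp (ENNReal.ofReal q) (fun p => Rgamma γ F p.1 p.2) ≤ C * circleLp ⊤ F := by
  obtain ⟨v, hv, hv1⟩ : ∃ v, max (1 / 2) (max ((3 - 2 * (γ * q)) / q) ((2 - γ * q) / q)) < v ∧ v < 1 := by
    apply exists_between
    simp only [max_lt_iff, div_lt_one hq]
    exact ⟨by norm_num, h2, h3⟩
  simp only [max_lt_iff, div_lt_iff₀ hq] at hv
  obtain ⟨hv0, hv2, hv3⟩ := hv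
  have hvp : 0 < 1 - v := by linarith
  have hr : 1 < 1 / (1 - v) := by rw [lt_div_iff₀ hvp]; linarith
  have e : 1 - 1 / (1 / (1 - v)) = v := by rw [one_div_one_div]; ring
  obtain ⟨C, hC, h⟩ := finite_case γ q (1 / (1 - v)) hγ hq hr h1 (by rw [e]; exact hv2) (by rw [e]; exact hv3)
  set r := 1 / (1 - v) with hrd
  set μ := (volume.restrict (Ioc (0:ℝ) (2 * π))) with hμ
  set c : ℝ≥0∞ := μ univ ^ (1 / (ENNReal.ofReal r).toReal - 1 / (⊤ : ℝ≥0∞).toReal) with hc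
  have hct : c ≠ ⊤ := by
    rw [hc]
    refine ENNReal.rpow_ne_top_of_nonneg ?_ (measure_ne_top μ univ)
    simp
  have hle : ∀ F : ℝ → ℂ, Measurable F → circleLp (ENNReal.ofReal r) F ≤ circleLp ⊤ F * c := fun F hF =>
    eLpNorm_le_eLpNorm_mul_rpow_measure_univ le_top hF.aestronglyMeasurable
  refine ⟨C * c, ENNReal.mul_ne_top hC hct, ?_⟩
  intro F hF hN
  refine (h F hF (ne_top_of_le_ne_top (ENNReal.mul_ne_top hN hct) (hle F hF))).trans ?_
  calc _ ≤ C * (circleLp ⊤ F * c) := by gcongr; exact hle F hF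
    _ = _ := by ring

lemma combine (γ q : ℝ) (r : ℝ≥0∞) (h : ∃ C : ℝ≥0∞, C ≠ ⊤ ∧ ∀ F : ℝ → ℂ, Measurable F → circleLp r F ≠ ⊤ →
      planeLp (ENNReal.ofReal q) (fun p => Rgamma γ F p.1 p.2) ≤ C * circleLp r F) :
    ∃ C : ℝ, 0 < C ∧ ∀ F : ℝ → ℂ, Measurable F →
      planeLp (ENNReal.ofReal q) (fun p => Rgamma γ F p.1 p.2) ≤
        ENNReal.ofReal C * circleLp r F := by
  obtain ⟨C, hC, h⟩ := h
  refine ⟨C.toReal + 1, by positivity, fun F hF => ?_⟩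
  by_cases hN : circleLp r F = ⊤
  · rw [hN, ENNReal.mul_top]
    · exact le_top
    · have : 0 < C.toReal + 1 := by positivity
      simpa using this
  · refine (h F hF hN).trans ?_
    gcongr
    rw [ENNReal.le_ofReal_iff_toReal_le hC (by positivity)]
    linarith

/-- Theorem 6 (sufficiency, non-endpoint case) for `R*_γ`. -/
theorem statement2 (γ : ℝ) (hγ : 0 ≤ γ)
    (r : ℝ≥0∞) (hr : 1 ≤ r) (q : ℝ) (hq : 0 < q)
    (h1 : γ > 2 / q - 1 / 2)
    (h2 : γ > max (3 / (2 * q) - (1 - r⁻¹.toReal) / 2) (2 / q - (1 - r⁻¹.toReal))) :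
    ∃ C : ℝ, 0 < C ∧ ∀ F : ℝ → ℂ, Measurable F →
      planeLp (ENNReal.ofReal q) (fun p => Rgamma γ F p.1 p.2) ≤
        ENNReal.ofReal C * circleLp r F := by
  have g1 : 2 - γ * q < q / 2 := by
    have := mul_lt_mul_of_pos_right h1 hq
    rw [sub_mul, div_mul_cancel₀ _ hq.ne'] at this
    linarith
  obtain ⟨h2, h3⟩ := max_lt_iff.1 h2
  have g2 : 3 - 2 * (γ * q) < (1 - r⁻¹.toReal) * q := by
    have := mul_lt_mul_of_pos_right h2 hq
    have e : (3 / (2 * q) - (1 - r⁻¹.toReal) / 2) * q = 3 / 2 - (1 - r⁻¹.toReal) * q / 2 := by field_simp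
    rw [e] at this
    linarith
  have g3 : 2 - γ * q < (1 - r⁻¹.toReal) * q := by
    have := mul_lt_mul_of_pos_right h3 hq
    rw [sub_mul, div_mul_cancel₀ _ hq.ne'] at this
    linarith
  apply combine
  rcases eq_or_ne r ⊤ with rfl | hrt
  · simp only [ENNReal.inv_top, ENNReal.toReal_zero, sub_zero, one_mul] at g2 g3
    exact top_case γ q hγ hq g1 g2 g3
  rcases eq_or_lt_of_le hr with rfl | hr1
  · simp only [inv_one, ENNReal.toReal_one, sub_self, zero_mul] at g3
    obtain ⟨C, hC, h⟩ := one_case γ q hq (by linarith)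
    exact ⟨C, hC, fun F hF _ => h F hF⟩
  · have hr' : 1 < r.toReal := by
      rw [← ENNReal.toReal_one]
      exact (ENNReal.toReal_lt_toReal (by norm_num) hrt).2 hr1
    rw [ENNReal.toReal_inv, ← one_div] at g2 g3
    have := finite_case γ q r.toReal hγ hq hr' g1 g2 g3
    rwa [ENNReal.ofReal_toReal hrt] at this
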